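/- There exist absolute positive constants C₀ and C₀′ such that the following holds. Let U be an n×n real matrix with UᵀU = n·I and coherence μ(U) = max_{k,j} |U_{k,j}|. Fix a subset T ⊆ {1,…,n} and δ ∈ (0,1). Let Ω ⊆ {1,…,n} be chosen uniformly at random among all subsets of size m, and let z ∈ {−1,+1}^T be a uniformly random sign sequence independent of Ω. If m ≥ C₀ · |T| · μ(U)² · log(n/δ) and m ≥ C₀′ · log²(n/δ), then with probability exceeding 1 − δ the following event holds: every x⁰ ∈ ℝⁿ supported on T whose sign sequence on T equals z is the unique solution of the convex program min_x ‖x‖_{ℓ₁} subject to U_Ω x = U_Ω x⁰. -/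

import Mathlib

open Classical Finset Matrix Real

/-- Spectral (operator ℓ²) norm of a real matrix. -/
noncomputable def specNorm {ι κ : Type*} [Fintype ι] [Fintype κ] [DecidableEq κ]
    (A : Matrix ι κ ℝ) : ℝ :=
  ‖LinearMap.toContinuousLinearMap (Matrix.toEuclideanLin A)‖

/-- Coherence: the largest magnitude among the entries of `U`. -/
noncomputable def coh {n : ℕ} (U : Matrix (Fin n) (Fin n) ℝ) : ℝ :=
  ⨆ k, ⨆ j, |U k j|

/-- Uniform probability of the event `E` on the finite sample space `s`. -/
noncomputable def uprob {α : Type*} (s : Finset α) (E : α → Prop) : ℝ :=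
  ((s.filter E).card : ℝ) / s.card

/-- Weight of the outcome `ω` for i.i.d. Bernoulli(m/n) variables `δ_k = ω k`. -/
noncomputable def bweight (n m : ℕ) (ω : Fin n → Bool) : ℝ :=
  ∏ k, if ω k then (m : ℝ) / n else 1 - (m : ℝ) / n

/-- Expectation under the i.i.d. Bernoulli(m/n) model. -/
noncomputable def bexp (n m : ℕ) (f : (Fin n → Bool) → ℝ) : ℝ :=
  ∑ ω : Fin n → Bool, bweight n m ω * f ω

/-- Probability of an event under the i.i.d. Bernoulli(m/n) model. -/
noncomputable def bprob (n m : ℕ) (E : (Fin n → Bool) → Prop) : ℝ :=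
  ∑ ω : Fin n → Bool, if E ω then bweight n m ω else 0

/-- Euclidean norm of a finitely indexed real vector. -/
noncomputable def l2norm {ι : Type*} [Fintype ι] (v : ι → ℝ) : ℝ :=
  Real.sqrt (∑ i, v i ^ 2)

theorem sum_update_swap {ι α : Type*} [Fintype ι] [DecidableEq ι] [Fintype α] (j : ι)
    (g : (ι → α) → (ι → α) → ℝ) :
    ∑ φ, ∑ k, g φ (Function.update φ j k) = ∑ φ, ∑ k, g (Function.update φ j k) φ := by
  simp only [← Fintype.sum_prod_type']
  let e : (ι → α) × α → (ι → α) × α := fun p => (Function.update p.1 j p.2, p.1 j)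
  have he : Function.Involutive e := fun p => by simp [e]
  exact Fintype.sum_equiv he.toPerm _ _ fun p => by simp [e]

theorem sum_bilin_eq_sum_exchange {ι α M : Type*} [Fintype ι] [DecidableEq ι] [Fintype α]
    [AddCommGroup M] [Module ℝ M] (L : M →ₗ[ℝ] M →ₗ[ℝ] ℝ) (y : α → M) (c : M)
    (hc : ∑ k, y k = (Fintype.card α : ℝ) • c) (Ψ : (ι → α) → M) :
    2 * (Fintype.card α : ℝ) * ∑ φ : ι → α, L (∑ j, y (φ j) - (Fintype.card ι : ℝ) • c) (Ψ φ) =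
      ∑ j, ∑ φ : ι → α, ∑ k,
        L (y (φ j) - y k) (Ψ φ - Ψ (Function.update φ j k)) := by
  have h1 : ∀ φ : ι → α,
      (Fintype.card α : ℝ) * L (∑ j, y (φ j) - (Fintype.card ι : ℝ) • c) (Ψ φ) =
        ∑ j, ∑ k, L (y (φ j) - y k) (Ψ φ) := by
    intro φ
    have : ∑ j, ∑ k, (y (φ j) - y k) =
        (Fintype.card α : ℝ) • (∑ j, y (φ j) - (Fintype.card ι : ℝ) • c) := by
      simp only [Finset.sum_sub_distrib, hc, Finset.sum_const, Finset.card_univ, smul_sub,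
        Finset.smul_sum, ← Nat.cast_smul_eq_nsmul ℝ]
      rw [smul_comm]
    rw [← smul_eq_mul, ← LinearMap.smul_apply, ← map_smul, ← this]
    simp
  have h2 : ∀ j, ∑ φ : ι → α, ∑ k, L (y (φ j) - y k) (Ψ φ - Ψ (Function.update φ j k)) =
      2 * ∑ φ : ι → α, ∑ k, L (y (φ j) - y k) (Ψ φ) := by
    intro j
    have := sum_update_swap (α := α) j (fun φ ψ => L (y (φ j) - y (ψ j)) (Ψ ψ))
    simp only [Function.update_self] at this
    have h3 : ∀ (φ : ι → α) k, L (y k - y (φ j)) (Ψ φ) = - L (y (φ j) - y k) (Ψ φ) := by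
      intro φ k; rw [← neg_sub, map_neg]; rfl
    simp only [map_sub, Finset.sum_sub_distrib] at this h3 ⊢
    simp only [LinearMap.sub_apply, Finset.sum_sub_distrib] at this h3 ⊢
    linarith
  rw [Finset.sum_congr rfl fun j _ => h2 j, ← Finset.mul_sum, Finset.sum_comm, mul_assoc,
    Finset.mul_sum, Finset.sum_congr rfl fun φ _ => h1 φ]

theorem exists_diagonalization {τ : Type*} [Fintype τ] [DecidableEq τ] {X : Matrix τ τ ℝ}
    (hX : X.IsHermitian) :
    ∃ (P : Matrix τ τ ℝ) (l : τ → ℝ), Pᵀ * P = 1 ∧ P * Pᵀ = 1 ∧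
      ∀ a : ℕ, X ^ a = P * diagonal (fun i => l i ^ a) * Pᵀ := by
  let P : Matrix τ τ ℝ := hX.eigenvectorUnitary
  have h1 : Pᵀ * P = 1 := by
    have := Unitary.coe_star_mul_self hX.eigenvectorUnitary
    simpa [P, star_eq_conjTranspose, conjTranspose_eq_transpose_of_trivial] using this
  have h2 : P * Pᵀ = 1 := by
    have := Unitary.coe_mul_star_self hX.eigenvectorUnitary
    simpa [P, star_eq_conjTranspose, conjTranspose_eq_transpose_of_trivial] using this
  refine ⟨P, hX.eigenvalues, h1, h2, fun a => ?_⟩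
  have h3 : X = P * diagonal hX.eigenvalues * Pᵀ := by
    have := hX.spectral_theorem
    rw [Unitary.conjStarAlgAut_apply] at this
    simpa [P, star_eq_conjTranspose, conjTranspose_eq_transpose_of_trivial,
      Function.comp_def] using this
  induction a with
  | zero => simp [h2]
  | succ a ih =>
    rw [pow_succ, ih]
    nth_rewrite 2 [h3]
    calc _ = P * diagonal (fun i => hX.eigenvalues i ^ a) * (Pᵀ * P) *
          diagonal hX.eigenvalues * Pᵀ := by simp only [Matrix.mul_assoc]
      _ = _ := by
        rw [h1, Matrix.mul_one, Matrix.mul_assoc P, diagonal_mul_diagonal]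
        simp only [pow_succ]

theorem exists_trace_pow_mul_pow {τ : Type*} [Fintype τ] [DecidableEq τ] {W Y : Matrix τ τ ℝ}
    (hW : W.IsHermitian) (hY : Y.IsHermitian) :
    ∃ (l v : τ → ℝ) (c : τ → τ → ℝ), (∀ i j, 0 ≤ c i j) ∧
      ∀ a b : ℕ, (W ^ a * Y ^ b).trace = ∑ i, ∑ j, c i j * (l i ^ a * v j ^ b) := by
  obtain ⟨P, l, -, -, hP⟩ := exists_diagonalization hW
  obtain ⟨Q, v, -, -, hQ⟩ := exists_diagonalization hY
  refine ⟨l, v, fun i j => (Pᵀ * Q) i j ^ 2, fun i j => sq_nonneg _, fun a b => ?_⟩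
  rw [hP, hQ]
  calc _ = (diagonal (fun i => l i ^ a) * (Pᵀ * Q) * (diagonal (fun i => v i ^ b) *
        (Pᵀ * Q)ᵀ)).trace := by
        rw [Matrix.mul_assoc P, Matrix.mul_assoc P, Matrix.trace_mul_comm]
        simp only [Matrix.mul_assoc, transpose_mul, transpose_transpose]
    _ = _ := by
      generalize Pᵀ * Q = C
      rw [Matrix.trace]
      refine Finset.sum_congr rfl fun i _ => ?_
      rw [Matrix.diag_apply, Matrix.mul_apply]
      refine Finset.sum_congr rfl fun j _ => ?_
      rw [diagonal_mul, diagonal_mul, transpose_apply]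
      ring

theorem exists_trace_pow_and_dotProduct {τ : Type*} [Fintype τ] [DecidableEq τ]
    {X : Matrix τ τ ℝ} (hX : X.IsHermitian) :
    ∃ l : τ → ℝ, (∀ a : ℕ, (X ^ a).trace = ∑ i, l i ^ a) ∧
      ∀ v : τ → ℝ, ∃ q : τ → ℝ, (∀ i, 0 ≤ q i) ∧ v ⬝ᵥ v = ∑ i, q i ∧
        v ⬝ᵥ (X *ᵥ v) = ∑ i, l i * q i := by
  obtain ⟨P, l, h1, h2, hP⟩ := exists_diagonalization hX
  refine ⟨l, fun a => ?_, fun v => ⟨fun i => (Pᵀ *ᵥ v) i ^ 2, fun i => sq_nonneg _, ?_, ?_⟩⟩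
  · rw [hP, Matrix.trace_mul_comm, ← Matrix.mul_assoc, h1, Matrix.one_mul, trace_diagonal]
  · have : v ⬝ᵥ v = (Pᵀ *ᵥ v) ⬝ᵥ (Pᵀ *ᵥ v) := by
      rw [dotProduct_mulVec, vecMul_transpose, mulVec_mulVec, h2, one_mulVec]
    rw [this]; simp [dotProduct, pow_two]
  · have h3 := hP 1
    simp only [pow_one] at h3
    have : v ⬝ᵥ (X *ᵥ v) = (Pᵀ *ᵥ v) ⬝ᵥ (diagonal l *ᵥ (Pᵀ *ᵥ v)) := by
      nth_rewrite 1 [h3]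
      rw [← mulVec_mulVec, ← mulVec_mulVec, dotProduct_mulVec v P, ← mulVec_transpose]
    rw [this]; simp only [dotProduct, mulVec_diagonal]
    exact Finset.sum_congr rfl fun i _ => by ring

theorem sub_mul_pow_sub_pow_le (x y : ℝ) (p : ℕ) :
    (x - y) * (x ^ (2 * p + 1) - y ^ (2 * p + 1)) ≤
      (2 * p + 1) * ((x - y) ^ 2 * (x ^ (2 * p) + y ^ (2 * p))) := by
  have h := Commute.geom_sum₂_mul (Commute.all x y) (2 * p + 1)
  rw [← h, mul_comm (∑ i ∈ _, _), ← mul_assoc, ← pow_two]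
  rw [mul_left_comm]
  refine mul_le_mul_of_nonneg_left ?_ (sq_nonneg _)
  have hb : ∀ i ∈ Finset.range (2 * p + 1),
      x ^ i * y ^ (2 * p + 1 - 1 - i) ≤ x ^ (2 * p) + y ^ (2 * p) := by
    intro i hi
    have hi' : i ≤ 2 * p := by simp at hi; omega
    have hm : |x| ^ i * |y| ^ (2 * p - i) ≤ max |x| |y| ^ (2 * p) := by
      calc _ ≤ max |x| |y| ^ i * max |x| |y| ^ (2 * p - i) := by
            gcongr
            · exact le_max_left _ _
            · exact le_max_right _ _
        _ = _ := by rw [← pow_add]; congr 1; omega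
    have h2 : max |x| |y| ^ (2 * p) ≤ x ^ (2 * p) + y ^ (2 * p) := by
      have hx : |x| ^ (2 * p) = x ^ (2 * p) := (even_two_mul p).pow_abs x
      have hy : |y| ^ (2 * p) = y ^ (2 * p) := (even_two_mul p).pow_abs y
      have hx0 : 0 ≤ x ^ (2 * p) := (even_two_mul p).pow_nonneg x
      have hy0 : 0 ≤ y ^ (2 * p) := (even_two_mul p).pow_nonneg y
      rcases max_choice |x| |y| with h | h <;> rw [h] <;> linarith
    calc _ ≤ |x ^ i * y ^ (2 * p + 1 - 1 - i)| := le_abs_self _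
      _ = |x| ^ i * |y| ^ (2 * p - i) := by simp [abs_mul, abs_pow]
      _ ≤ _ := hm.trans h2
  calc _ ≤ ∑ i ∈ Finset.range (2 * p + 1), (x ^ (2 * p) + y ^ (2 * p)) := Finset.sum_le_sum hb
    _ = _ := by simp; ring

/-- Trace inequality for the divided difference of an odd power. -/
theorem trace_sub_mul_pow_sub_pow_le {τ : Type*} [Fintype τ] [DecidableEq τ]
    {W Y : Matrix τ τ ℝ} (hW : W.IsHermitian) (hY : Y.IsHermitian) (p : ℕ) :
    ((W - Y) * (W ^ (2 * p + 1) - Y ^ (2 * p + 1))).trace ≤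
      (2 * p + 1) * (((W - Y) ^ 2 * W ^ (2 * p)).trace + ((W - Y) ^ 2 * Y ^ (2 * p)).trace) := by
  obtain ⟨l, v, c, hc, h⟩ := exists_trace_pow_mul_pow hW hY
  have e1 : ((W - Y) * (W ^ (2 * p + 1) - Y ^ (2 * p + 1))).trace =
      (W ^ (2 * p + 2) * Y ^ 0).trace - (W ^ 1 * Y ^ (2 * p + 1)).trace
        - (W ^ (2 * p + 1) * Y ^ 1).trace + (W ^ 0 * Y ^ (2 * p + 2)).trace := by
    rw [Matrix.trace_mul_comm (W ^ (2 * p + 1)) (Y ^ 1)]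
    simp only [← trace_sub, ← trace_add]
    congr 1
    simp only [pow_zero, pow_one, mul_one, one_mul, sub_mul, mul_sub, ← pow_succ']
    abel
  have e2 : ((W - Y) ^ 2 * W ^ (2 * p)).trace = (W ^ (2 * p + 2) * Y ^ 0).trace -
      2 * (W ^ (2 * p + 1) * Y ^ 1).trace + (W ^ (2 * p) * Y ^ 2).trace := by
    have : (W - Y) ^ 2 * W ^ (2 * p) = W ^ (2 * p + 2) - W * (Y * W ^ (2 * p))
        - Y * W ^ (2 * p + 1) + Y ^ 2 * W ^ (2 * p) := by
      rw [pow_succ' W (2 * p + 1), pow_succ' W (2 * p)]; noncomm_ring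
    rw [this, trace_add, trace_sub, trace_sub, Matrix.trace_mul_comm (Y ^ 2),
      Matrix.trace_mul_comm W (Y * _), Matrix.mul_assoc, ← pow_succ,
      Matrix.trace_mul_comm Y]
    simp; ring
  have e3 : ((W - Y) ^ 2 * Y ^ (2 * p)).trace = (W ^ 0 * Y ^ (2 * p + 2)).trace -
      2 * (W ^ 1 * Y ^ (2 * p + 1)).trace + (W ^ 2 * Y ^ (2 * p)).trace := by
    have : (W - Y) ^ 2 * Y ^ (2 * p) = Y ^ (2 * p + 2) - Y * (W * Y ^ (2 * p))
        - W * Y ^ (2 * p + 1) + W ^ 2 * Y ^ (2 * p) := by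
      rw [pow_succ' Y (2 * p + 1), pow_succ' Y (2 * p)]; noncomm_ring
    rw [this, trace_add, trace_sub, trace_sub,
      Matrix.trace_mul_comm Y (W * _), Matrix.mul_assoc, ← pow_succ]
    simp; ring
  rw [e1, e2, e3]
  simp only [h, Finset.mul_sum, ← Finset.sum_add_distrib, ← Finset.sum_sub_distrib]
  refine Finset.sum_le_sum fun i _ => Finset.sum_le_sum fun j _ => ?_
  have := mul_le_mul_of_nonneg_left (sub_mul_pow_sub_pow_le (l i) (v j) p) (hc i j)
  refine le_of_eq_of_le ?_ (this.trans_eq ?_) <;> ring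

theorem pow_mul_pow_le_add {a b : ℝ} (ha : 0 ≤ a) (hb : 0 ≤ b) (i j : ℕ) :
    a ^ i * b ^ j ≤ a ^ (i + j) + b ^ (i + j) := by
  have h : a ^ i * b ^ j ≤ max a b ^ (i + j) := by
    rw [pow_add]
    gcongr
    · exact le_max_left _ _
    · exact le_max_right _ _
  have h1 := pow_nonneg ha (i + j)
  have h2 := pow_nonneg hb (i + j)
  rcases max_choice a b with e | e <;> rw [e] at h <;> linarith

/-- The centred empirical second moment matrix `∑ j, u (φ j) (u (φ j))ᵀ - m I`. -/
noncomputable def gramDev {ι α τ : Type*} [Fintype ι] [Fintype τ] [DecidableEq τ]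
    (u : α → τ → ℝ) (φ : ι → α) : Matrix τ τ ℝ :=
  ∑ j, vecMulVec (u (φ j)) (u (φ j)) - (Fintype.card ι : ℝ) • 1

theorem gramDev_isHermitian {ι α τ : Type*} [Fintype ι] [Fintype τ] [DecidableEq τ]
    (u : α → τ → ℝ) (φ : ι → α) : (gramDev u φ).IsHermitian := by
  rw [gramDev, Matrix.IsHermitian, conjTranspose_eq_transpose_of_trivial]
  simp [transpose_sum, transpose_vecMulVec]

theorem sum_apply_update {ι α M : Type*} [Fintype ι] [DecidableEq ι] [AddCommGroup M]
    (y : α → M) (φ : ι → α) (j : ι) (k : α) :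
    y (φ j) - y k = ∑ i, y (φ i) - ∑ i, y (Function.update φ j k i) := by
  rw [← Finset.sum_sub_distrib, Finset.sum_eq_single j]
  · simp
  · intro i _ hi; simp [hi]
  · simp

theorem gramDev_sub_update {ι α τ : Type*} [Fintype ι] [DecidableEq ι] [Fintype τ]
    [DecidableEq τ] (u : α → τ → ℝ) (φ : ι → α) (j : ι) (k : α) :
    vecMulVec (u (φ j)) (u (φ j)) - vecMulVec (u k) (u k) =
      gramDev u φ - gramDev u (Function.update φ j k) := by
  rw [sum_apply_update (fun k => vecMulVec (u k) (u k)) φ j k, gramDev, gramDev]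
  abel

theorem trace_mul_mul_self_nonneg {τ : Type*} [Fintype τ] (M : Matrix τ τ ℝ) :
    0 ≤ (Mᵀ * M).trace := by
  simp only [Matrix.trace, Matrix.diag_apply, Matrix.mul_apply, transpose_apply]
  exact Finset.sum_nonneg fun i _ => Finset.sum_nonneg fun j _ => mul_self_nonneg _

theorem trace_sq_sub_mul_sq_le {τ : Type*} [Fintype τ] [DecidableEq τ] (K : Matrix τ τ ℝ)
    (hK : Kᵀ = K) {B : ℝ} (a b : τ → ℝ) (ha : a ⬝ᵥ a ≤ B) (hb : b ⬝ᵥ b ≤ B) :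
    ((vecMulVec a a - vecMulVec b b) ^ 2 * (K * K)).trace ≤
      2 * B * ((vecMulVec a a * (K * K)).trace + (vecMulVec b b * (K * K)).trace) := by
  have key : ∀ a : τ → ℝ, (vecMulVec a a * (vecMulVec a a * (K * K))).trace =
      (a ⬝ᵥ a) * (vecMulVec a a * (K * K)).trace := by
    intro a
    rw [← Matrix.mul_assoc, vecMulVec_mul_vecMulVec, vecMulVec_smul, smul_mul, trace_smul]
    rfl
  have pos : ∀ a : τ → ℝ, 0 ≤ (vecMulVec a a * (K * K)).trace := by
    intro a
    have : (vecMulVec a a * (K * K)).trace = (K *ᵥ a) ⬝ᵥ (K *ᵥ a) := by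
      rw [vecMulVec_mul, trace_vecMulVec, ← vecMul_vecMul, dotProduct_comm, ← dotProduct_mulVec,
        ← vecMul_transpose, hK]
    rw [this]; exact Finset.sum_nonneg fun i _ => mul_self_nonneg _
  have hsum := trace_mul_mul_self_nonneg ((vecMulVec a a + vecMulVec b b) * K)
  have e1 : (((vecMulVec a a + vecMulVec b b) * K)ᵀ * ((vecMulVec a a + vecMulVec b b) * K)).trace
      = ((vecMulVec a a + vecMulVec b b) ^ 2 * (K * K)).trace := by
    rw [transpose_mul, hK, transpose_add, transpose_vecMulVec, transpose_vecMulVec, Matrix.mul_assoc,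
      Matrix.trace_mul_comm, pow_two]
    simp only [Matrix.mul_assoc]
  rw [e1] at hsum
  have e2 : (vecMulVec a a - vecMulVec b b) ^ 2 * (K * K) +
      (vecMulVec a a + vecMulVec b b) ^ 2 * (K * K) =
      (2 : ℝ) • (vecMulVec a a * (vecMulVec a a * (K * K))) +
      (2 : ℝ) • (vecMulVec b b * (vecMulVec b b * (K * K))) := by
    rw [two_smul, two_smul]; noncomm_ring
  have e3 := congrArg Matrix.trace e2
  rw [trace_add, trace_add, trace_smul, trace_smul, key, key] at e3
  simp only [smul_eq_mul] at e3
  nlinarith [mul_le_mul_of_nonneg_right ha (pos a), mul_le_mul_of_nonneg_right hb (pos b)]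

theorem sum_trace_gramDev_pow_le_sum {ι α τ : Type*} [Fintype ι] [DecidableEq ι] [Fintype α]
    [Nonempty α] [Fintype τ] [DecidableEq τ] (u : α → τ → ℝ) {B : ℝ}
    (hB : ∀ k, u k ⬝ᵥ u k ≤ B)
    (hiso : ∑ k, vecMulVec (u k) (u k) = (Fintype.card α : ℝ) • (1 : Matrix τ τ ℝ)) (p : ℕ) :
    ∑ φ : ι → α, (gramDev u φ ^ (2 * p + 2)).trace ≤
      ∑ φ : ι → α, 2 * (2 * p + 1) * B * ((gramDev u φ ^ (2 * p + 1)).trace +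
        2 * Fintype.card ι * (gramDev u φ ^ (2 * p)).trace) := by
  have hN : (0 : ℝ) < Fintype.card α := by exact_mod_cast Fintype.card_pos
  have hY : ∀ φ : ι → α, ∑ j, vecMulVec (u (φ j)) (u (φ j)) =
      gramDev u φ + (Fintype.card ι : ℝ) • 1 := fun φ => by rw [gramDev]; abel
  have h1 := sum_bilin_eq_sum_exchange (ι := ι)
    ((LinearMap.mul ℝ (Matrix τ τ ℝ)).compr₂ (Matrix.traceLinearMap τ ℝ ℝ))
    (fun k => vecMulVec (u k) (u k)) 1 hiso (fun φ => gramDev u φ ^ (2 * p + 1))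
  simp only [LinearMap.compr₂_apply, LinearMap.mul_apply', traceLinearMap_apply] at h1
  have h2 : ∀ j : ι, ∑ φ : ι → α, ∑ k,
      ((vecMulVec (u (φ j)) (u (φ j)) - vecMulVec (u k) (u k)) *
        (gramDev u φ ^ (2 * p + 1) - gramDev u (Function.update φ j k) ^ (2 * p + 1))).trace ≤
      2 * (2 * p + 1) * ∑ φ : ι → α, ∑ k,
        ((vecMulVec (u (φ j)) (u (φ j)) - vecMulVec (u k) (u k)) ^ 2 *
          gramDev u φ ^ (2 * p)).trace := by
    intro j
    have hs := sum_update_swap (α := α) j (fun φ ψ =>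
      ((gramDev u φ - gramDev u ψ) ^ 2 * gramDev u ψ ^ (2 * p)).trace)
    have hsq : ∀ A C : Matrix τ τ ℝ, (A - C) ^ 2 = (C - A) ^ 2 := fun A C => by
      rw [← neg_sub, neg_sq]
    simp only [gramDev_sub_update]
    calc _ ≤ ∑ φ : ι → α, ∑ k, (2 * p + 1) * (((gramDev u φ -
          gramDev u (Function.update φ j k)) ^ 2 * gramDev u φ ^ (2 * p)).trace +
          ((gramDev u φ - gramDev u (Function.update φ j k)) ^ 2 *
            gramDev u (Function.update φ j k) ^ (2 * p)).trace) :=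
          Finset.sum_le_sum fun φ _ => Finset.sum_le_sum fun k _ =>
            trace_sub_mul_pow_sub_pow_le (gramDev_isHermitian _ _) (gramDev_isHermitian _ _) p
      _ = _ := by
        simp only [← Finset.mul_sum, Finset.sum_add_distrib]
        rw [hs]
        simp only [hsq (gramDev u (Function.update _ _ _))]
        ring
  have h3 : ∀ φ : ι → α, ∑ j, ∑ k, ((vecMulVec (u (φ j)) (u (φ j)) - vecMulVec (u k) (u k)) ^ 2 *
          gramDev u φ ^ (2 * p)).trace ≤ Fintype.card α * (2 * B *
          ((gramDev u φ ^ (2 * p + 1)).trace +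
            2 * Fintype.card ι * (gramDev u φ ^ (2 * p)).trace)) := by
    intro φ
    have hK : (gramDev u φ ^ p)ᵀ = gramDev u φ ^ p := by
      rw [transpose_pow]
      congr 1
      simpa [Matrix.IsHermitian, conjTranspose_eq_transpose_of_trivial] using
        gramDev_isHermitian u φ
    rw [two_mul p, pow_add]
    calc _ ≤ ∑ j, ∑ k, 2 * B *
          ((vecMulVec (u (φ j)) (u (φ j)) * (gramDev u φ ^ p * gramDev u φ ^ p)).trace +
          (vecMulVec (u k) (u k) * (gramDev u φ ^ p * gramDev u φ ^ p)).trace) :=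
          Finset.sum_le_sum fun j _ => Finset.sum_le_sum fun k _ =>
            trace_sq_sub_mul_sq_le _ hK _ _ (hB _) (hB _)
      _ = 2 * B * (Fintype.card α * ((∑ j, vecMulVec (u (φ j)) (u (φ j))) *
            (gramDev u φ ^ p * gramDev u φ ^ p)).trace +
            Fintype.card ι * ((∑ k, vecMulVec (u k) (u k)) *
            (gramDev u φ ^ p * gramDev u φ ^ p)).trace) := by
          simp only [← Finset.mul_sum, Finset.sum_add_distrib, Finset.sum_const, Finset.sum_mul,
            trace_sum, Finset.card_univ, nsmul_eq_mul]
      _ = _ := by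
          rw [hiso, hY, add_mul, trace_add, smul_mul, smul_mul, trace_smul, trace_smul,
            Matrix.one_mul, ← pow_add, ← pow_succ']
          simp only [smul_eq_mul]
          ring
  have h4 : 2 * (Fintype.card α : ℝ) * ∑ φ : ι → α, (gramDev u φ ^ (2 * p + 2)).trace ≤
      2 * Fintype.card α * ∑ φ : ι → α, 2 * (2 * p + 1) * B * ((gramDev u φ ^ (2 * p + 1)).trace +
        2 * Fintype.card ι * (gramDev u φ ^ (2 * p)).trace) := by
    calc _ = _ := by
          rw [← h1]
          simp only [pow_succ' _ (2 * p + 1)]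
          rfl
      _ ≤ ∑ j : ι, _ := Finset.sum_le_sum fun j _ => h2 j
      _ = 2 * (2 * p + 1) * ∑ φ : ι → α, ∑ j, ∑ k,
        ((vecMulVec (u (φ j)) (u (φ j)) - vecMulVec (u k) (u k)) ^ 2 *
          gramDev u φ ^ (2 * p)).trace := by
          rw [← Finset.mul_sum, Finset.sum_comm]
      _ ≤ 2 * (2 * p + 1) * ∑ φ : ι → α, Fintype.card α * (2 * B *
          ((gramDev u φ ^ (2 * p + 1)).trace +
            2 * Fintype.card ι * (gramDev u φ ^ (2 * p)).trace)) := by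
          gcongr with φ _
          exact h3 φ
      _ = _ := by
          simp only [Finset.mul_sum]
          exact Finset.sum_congr rfl fun φ _ => by ring
  exact le_of_mul_le_mul_left h4 (by positivity)

/-- Moment bound for the deviation of an empirical second moment matrix from its mean. -/
theorem sum_trace_gramDev_pow_le {ι α τ : Type*} [Fintype ι] [DecidableEq ι] [Fintype α]
    [Nonempty α] [Fintype τ] [DecidableEq τ] (u : α → τ → ℝ) {B : ℝ}
    (hB : ∀ k, u k ⬝ᵥ u k ≤ B)
    (hiso : ∑ k, vecMulVec (u k) (u k) = (Fintype.card α : ℝ) • (1 : Matrix τ τ ℝ)) (p : ℕ)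
    (hp : 1088 * (p + 1) * B ≤ Fintype.card ι) :
    ∑ φ : ι → α, (gramDev u φ ^ (2 * p + 2)).trace ≤
      Fintype.card (ι → α) * (Fintype.card τ * ((Fintype.card ι : ℝ) / 8) ^ (2 * p + 2)) := by
  have hB0 : 0 ≤ B := (Finset.sum_nonneg fun i _ => mul_self_nonneg _).trans
    (hB (Classical.arbitrary α))
  set s : ℝ := (Fintype.card ι : ℝ) / 8 with hs
  have hs0 : 0 ≤ s := by positivity
  have hm : (Fintype.card ι : ℝ) = 8 * s := by rw [hs]; ring
  have hpt : ∀ φ : ι → α, 2 * (2 * p + 1) * B * ((gramDev u φ ^ (2 * p + 1)).trace +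
        2 * Fintype.card ι * (gramDev u φ ^ (2 * p)).trace) ≤
        ((gramDev u φ ^ (2 * p + 2)).trace + Fintype.card τ * s ^ (2 * p + 2)) / 2 := by
    intro φ
    obtain ⟨l, hl, -⟩ := exists_trace_pow_and_dotProduct (gramDev_isHermitian u φ)
    have hc : (Fintype.card τ : ℝ) * s ^ (2 * p + 2) = ∑ i : τ, s ^ (2 * p + 2) := by simp
    rw [hl, hl, hl, hc]
    simp only [Finset.mul_sum, ← Finset.sum_add_distrib, Finset.sum_div]
    refine Finset.sum_le_sum fun i _ => ?_
    have a1 := pow_mul_pow_le_add (abs_nonneg (l i)) hs0 (2 * p + 1) 1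
    have a2 := pow_mul_pow_le_add (abs_nonneg (l i)) hs0 (2 * p) 2
    have e2 : |l i| ^ (2 * p) = l i ^ (2 * p) := (even_two_mul p).pow_abs _
    have e3 : |l i| ^ (2 * p + 2) = l i ^ (2 * p + 2) :=
      Even.pow_abs (by simp [parity_simps]) _
    have e1 : l i ^ (2 * p + 1) ≤ |l i| ^ (2 * p + 1) := by
      rw [← abs_pow]; exact le_abs_self _
    rw [show 2 * p + 1 + 1 = 2 * p + 2 from rfl, pow_one, e3] at a1
    rw [e2, e3] at a2
    have hκ : 2 * (2 * p + 1) * B ≤ s / 34 := by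
      rw [hm] at hp; nlinarith
    have hq : 0 ≤ |l i| ^ (2 * p + 1) + 2 * Fintype.card ι * l i ^ (2 * p) := by
      have := (even_two_mul p).pow_nonneg (l i)
      positivity
    calc _ ≤ 2 * (2 * p + 1) * B * (|l i| ^ (2 * p + 1) + 2 * Fintype.card ι * l i ^ (2 * p)) := by
          gcongr
      _ ≤ s / 34 * (|l i| ^ (2 * p + 1) + 2 * Fintype.card ι * l i ^ (2 * p)) := by gcongr
      _ ≤ _ := by rw [hm]; nlinarith
  have h := (sum_trace_gramDev_pow_le_sum (ι := ι) u hB hiso p).trans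
    (Finset.sum_le_sum fun φ _ => hpt φ)
  rw [← Finset.sum_div, Finset.sum_add_distrib, Finset.sum_const, Finset.card_univ,
    nsmul_eq_mul] at h
  linarith

theorem pow_sub_pow_le_mul {a b : ℝ} (hb : 0 ≤ b) (hab : b ≤ a) (r : ℕ) :
    a ^ r - b ^ r ≤ (a - b) * (r * a ^ (r - 1)) := by
  have h := abs_pow_sub_pow_le a b r
  rw [abs_of_nonneg (sub_nonneg.2 (pow_le_pow_left₀ hb hab r)), abs_of_nonneg (sub_nonneg.2 hab),
    abs_of_nonneg (hb.trans hab), abs_of_nonneg hb, max_eq_left hab] at h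
  linarith

theorem dotProduct_sub_pow_smul_le {τ : Type*} [Fintype τ] (x y : τ → ℝ) (r : ℕ) :
    (x - y) ⬝ᵥ ((x ⬝ᵥ x) ^ r • x - (y ⬝ᵥ y) ^ r • y) ≤
      ((x - y) ⬝ᵥ (x - y)) / 2 * ((x ⬝ᵥ x) ^ r + (y ⬝ᵥ y) ^ r) +
      2 * r * (((x - y) ⬝ᵥ x) ^ 2 * (x ⬝ᵥ x) ^ (r - 1) +
        ((x - y) ⬝ᵥ y) ^ 2 * (y ⬝ᵥ y) ^ (r - 1)) := by
  have hA : 0 ≤ x ⬝ᵥ x := Finset.sum_nonneg fun i _ => mul_self_nonneg _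
  have hC : 0 ≤ y ⬝ᵥ y := Finset.sum_nonneg fun i _ => mul_self_nonneg _
  have hb : 0 ≤ (x - y) ⬝ᵥ (x - y) := Finset.sum_nonneg fun i _ => mul_self_nonneg _
  have e1 : (x - y) ⬝ᵥ (x - y) = (x - y) ⬝ᵥ x - (x - y) ⬝ᵥ y := by rw [dotProduct_sub]
  have e2 : x ⬝ᵥ x - y ⬝ᵥ y = (x - y) ⬝ᵥ x + (x - y) ⬝ᵥ y := by
    simp only [sub_dotProduct, dotProduct_comm y x]; ring
  rw [dotProduct_sub, dotProduct_smul, dotProduct_smul, smul_eq_mul, smul_eq_mul, e1]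
  rw [e1] at hb
  generalize (x - y) ⬝ᵥ x = s at *
  generalize (x - y) ⬝ᵥ y = t at *
  generalize x ⬝ᵥ x = A at *
  generalize y ⬝ᵥ y = C at *
  have hAr : 0 ≤ (r : ℝ) * A ^ (r - 1) := by positivity
  have hCr : 0 ≤ (r : ℝ) * C ^ (r - 1) := by positivity
  rcases le_total C A with h | h
  · have h1 := pow_sub_pow_le_mul hC h r
    have h2 : (s + t) ^ 2 ≤ 4 * s ^ 2 := by nlinarith
    have h3 := mul_le_mul_of_nonneg_left h1 (show 0 ≤ s + t by linarith)
    rw [e2] at h3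
    nlinarith [mul_le_mul_of_nonneg_right h2 hAr, mul_nonneg (sq_nonneg t) hCr]
  · have h1 := pow_sub_pow_le_mul hA h r
    have h2 : (s + t) ^ 2 ≤ 4 * t ^ 2 := by nlinarith
    have h3 := mul_le_mul_of_nonneg_left h1 (show 0 ≤ -(s + t) by linarith)
    rw [show C - A = -(s + t) by linarith] at h3
    nlinarith [mul_le_mul_of_nonneg_right h2 hCr, mul_nonneg (sq_nonneg s) hAr]

/-- The random vector `∑ j, c (φ j) u (φ j)`. -/
noncomputable def sampleVec {ι α τ : Type*} [Fintype ι] (c : α → ℝ) (u : α → τ → ℝ)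
    (φ : ι → α) : τ → ℝ :=
  ∑ j, c (φ j) • u (φ j)

theorem sampleVec_sub_update {ι α τ : Type*} [Fintype ι] [DecidableEq ι] (c : α → ℝ)
    (u : α → τ → ℝ) (φ : ι → α) (j : ι) (k : α) :
    c (φ j) • u (φ j) - c k • u k = sampleVec c u φ - sampleVec c u (Function.update φ j k) :=
  sum_apply_update (fun k => c k • u k) φ j k

theorem sum_sampleVec_pow_le_sum {ι α τ : Type*} [Fintype ι] [DecidableEq ι] [Fintype α]
    [Nonempty α] [Fintype τ] [DecidableEq τ] (c : α → ℝ) (u : α → τ → ℝ) {B D : ℝ}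
    (hB : ∀ k, u k ⬝ᵥ u k ≤ B) (hD : ∀ k, c k ^ 2 ≤ D)
    (hiso : ∑ k, vecMulVec (u k) (u k) = (Fintype.card α : ℝ) • (1 : Matrix τ τ ℝ))
    (hc : ∑ k, c k ^ 2 = Fintype.card α) (hcu : ∑ k, c k • u k = 0) (r : ℕ) :
    ∑ φ : ι → α, (sampleVec c u φ ⬝ᵥ sampleVec c u φ) ^ (r + 1) ≤
      ∑ φ : ι → α, (B * (∑ j, c (φ j) ^ 2 + Fintype.card ι) *
          (sampleVec c u φ ⬝ᵥ sampleVec c u φ) ^ r +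
        4 * r * D * (sampleVec c u φ ⬝ᵥ (gramDev u φ *ᵥ sampleVec c u φ) +
          2 * Fintype.card ι * (sampleVec c u φ ⬝ᵥ sampleVec c u φ)) *
          (sampleVec c u φ ⬝ᵥ sampleVec c u φ) ^ (r - 1)) := by
  have hN : (0 : ℝ) < Fintype.card α := by exact_mod_cast Fintype.card_pos
  set v : (ι → α) → τ → ℝ := sampleVec c u with hv
  have hq : ∀ φ, 0 ≤ v φ ⬝ᵥ v φ := fun φ => Finset.sum_nonneg fun i _ => mul_self_nonneg _
  have h1 := sum_bilin_eq_sum_exchange (ι := ι) (dotProductBilin ℝ ℝ)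
    (fun k => c k • u k) 0 (by rw [hcu, smul_zero]) (fun φ => (v φ ⬝ᵥ v φ) ^ r • v φ)
  simp only [smul_zero, sub_zero, dotProductBilin_apply_apply] at h1
  have h2 : ∀ j : ι, ∑ φ : ι → α, ∑ k, (c (φ j) • u (φ j) - c k • u k) ⬝ᵥ
      ((v φ ⬝ᵥ v φ) ^ r • v φ - (v (Function.update φ j k) ⬝ᵥ v (Function.update φ j k)) ^ r •
        v (Function.update φ j k)) ≤
      ∑ φ : ι → α, ∑ k, (((c (φ j) • u (φ j) - c k • u k) ⬝ᵥ (c (φ j) • u (φ j) - c k • u k)) *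
        (v φ ⬝ᵥ v φ) ^ r + 4 * r * (((c (φ j) • u (φ j) - c k • u k) ⬝ᵥ v φ) ^ 2 *
        (v φ ⬝ᵥ v φ) ^ (r - 1))) := by
    intro j
    have s1 := sum_update_swap (α := α) j (fun φ ψ =>
      ((v φ - v ψ) ⬝ᵥ (v φ - v ψ)) / 2 * (v ψ ⬝ᵥ v ψ) ^ r)
    have s2 := sum_update_swap (α := α) j (fun φ ψ =>
      2 * r * (((v φ - v ψ) ⬝ᵥ v ψ) ^ 2 * (v ψ ⬝ᵥ v ψ) ^ (r - 1)))
    have f1 : ∀ a b : τ → ℝ, (a - b) ⬝ᵥ (a - b) = (b - a) ⬝ᵥ (b - a) := fun a b => by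
      rw [← neg_sub, neg_dotProduct, dotProduct_neg, neg_neg]
    have f2 : ∀ a b w : τ → ℝ, ((a - b) ⬝ᵥ w) ^ 2 = ((b - a) ⬝ᵥ w) ^ 2 := fun a b w => by
      rw [← neg_sub, neg_dotProduct, neg_sq]
    simp only [hv, sampleVec_sub_update] at s1 s2 ⊢
    refine (Finset.sum_le_sum fun φ _ => Finset.sum_le_sum fun k _ =>
      dotProduct_sub_pow_smul_le (sampleVec c u φ)
        (sampleVec c u (Function.update φ j k)) r).trans_eq ?_
    simp only [mul_add, Finset.sum_add_distrib]
    rw [s1, s2]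
    simp only [f1 (sampleVec c u (Function.update _ _ _)),
      f2 (sampleVec c u (Function.update _ _ _))]
    simp only [← Finset.sum_add_distrib]
    refine Finset.sum_congr rfl fun φ _ => Finset.sum_congr rfl fun k _ => by ring
  have hu : ∀ w : τ → ℝ, ∑ k, (u k ⬝ᵥ w) ^ 2 = Fintype.card α * (w ⬝ᵥ w) := by
    intro w
    have := congrArg (fun M : Matrix τ τ ℝ => w ⬝ᵥ (M *ᵥ w)) hiso
    simp only [sum_mulVec, smul_mulVec, one_mulVec, dotProduct_smul, smul_eq_mul,
      dotProduct_sum] at this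
    rw [← this]
    refine Finset.sum_congr rfl fun k _ => ?_
    rw [vecMulVec_mulVec, dotProduct_smul, dotProduct_comm w]
    simp [pow_two]
  have hg : ∀ (φ : ι → α) (w : τ → ℝ), ∑ j, (u (φ j) ⬝ᵥ w) ^ 2 =
      w ⬝ᵥ (gramDev u φ *ᵥ w) + Fintype.card ι * (w ⬝ᵥ w) := by
    intro φ w
    rw [gramDev, sub_mulVec, sum_mulVec, dotProduct_sub, dotProduct_sum, smul_mulVec, one_mulVec,
      dotProduct_smul, smul_eq_mul, sub_add_cancel]
    refine Finset.sum_congr rfl fun k _ => ?_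
    rw [vecMulVec_mulVec, dotProduct_smul, dotProduct_comm w]
    simp [pow_two]
  have h3 : ∀ φ : ι → α, ∑ j, ∑ k, (((c (φ j) • u (φ j) - c k • u k) ⬝ᵥ
        (c (φ j) • u (φ j) - c k • u k)) *
        (v φ ⬝ᵥ v φ) ^ r + 4 * r * (((c (φ j) • u (φ j) - c k • u k) ⬝ᵥ v φ) ^ 2 *
        (v φ ⬝ᵥ v φ) ^ (r - 1))) ≤ 2 * Fintype.card α *
      (B * (∑ j, c (φ j) ^ 2 + Fintype.card ι) * (v φ ⬝ᵥ v φ) ^ r +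
        4 * r * D * (v φ ⬝ᵥ (gramDev u φ *ᵥ v φ) + 2 * Fintype.card ι * (v φ ⬝ᵥ v φ)) *
          (v φ ⬝ᵥ v φ) ^ (r - 1)) := by
    intro φ
    have g1 : ∀ k l, (c k • u k - c l • u l) ⬝ᵥ (c k • u k - c l • u l) ≤
        2 * B * (c k ^ 2 + c l ^ 2) := by
      intro k l
      have g0 : 0 ≤ (c k • u k + c l • u l) ⬝ᵥ (c k • u k + c l • u l) :=
        Finset.sum_nonneg fun i _ => mul_self_nonneg _
      simp only [sub_dotProduct, dotProduct_sub, add_dotProduct, dotProduct_add, smul_dotProduct,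
        dotProduct_smul, smul_eq_mul] at g0 ⊢
      nlinarith [mul_le_mul_of_nonneg_left (hB k) (sq_nonneg (c k)),
        mul_le_mul_of_nonneg_left (hB l) (sq_nonneg (c l))]
    have g2 : ∀ k l, ((c k • u k - c l • u l) ⬝ᵥ v φ) ^ 2 ≤
        2 * D * ((u k ⬝ᵥ v φ) ^ 2 + (u l ⬝ᵥ v φ) ^ 2) := by
      intro k l
      simp only [sub_dotProduct, smul_dotProduct, smul_eq_mul]
      nlinarith [mul_le_mul_of_nonneg_right (hD k) (sq_nonneg (u k ⬝ᵥ v φ)),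
        mul_le_mul_of_nonneg_right (hD l) (sq_nonneg (u l ⬝ᵥ v φ)),
        sq_nonneg (c k * (u k ⬝ᵥ v φ) + c l * (u l ⬝ᵥ v φ))]
    calc _ ≤ ∑ j, ∑ k, (2 * B * (c (φ j) ^ 2 + c k ^ 2) * (v φ ⬝ᵥ v φ) ^ r +
          4 * r * (2 * D * ((u (φ j) ⬝ᵥ v φ) ^ 2 + (u k ⬝ᵥ v φ) ^ 2) *
            (v φ ⬝ᵥ v φ) ^ (r - 1))) := by
          have := hq φ
          gcongr with j _ k _
          · exact g1 _ _
          · exact g2 _ _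
      _ = 2 * B * (Fintype.card α * ∑ j, c (φ j) ^ 2 + Fintype.card ι * ∑ k, c k ^ 2) *
            (v φ ⬝ᵥ v φ) ^ r + 4 * r * (2 * D * (Fintype.card α * ∑ j, (u (φ j) ⬝ᵥ v φ) ^ 2 +
              Fintype.card ι * ∑ k, (u k ⬝ᵥ v φ) ^ 2) * (v φ ⬝ᵥ v φ) ^ (r - 1)) := by
          simp only [← Finset.mul_sum, ← Finset.sum_mul, Finset.sum_add_distrib,
            Finset.sum_const, Finset.card_univ, nsmul_eq_mul]
      _ = _ := by rw [hc, hu, hg]; ring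
  have h4 : 2 * (Fintype.card α : ℝ) * ∑ φ : ι → α, (v φ ⬝ᵥ v φ) ^ (r + 1) ≤
      2 * Fintype.card α * ∑ φ : ι → α, (B * (∑ j, c (φ j) ^ 2 + Fintype.card ι) *
          (v φ ⬝ᵥ v φ) ^ r +
        4 * r * D * (v φ ⬝ᵥ (gramDev u φ *ᵥ v φ) + 2 * Fintype.card ι * (v φ ⬝ᵥ v φ)) *
          (v φ ⬝ᵥ v φ) ^ (r - 1)) := by
    have h5 : 2 * (Fintype.card α : ℝ) * ∑ φ : ι → α, (v φ ⬝ᵥ v φ) ^ (r + 1) =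
        2 * Fintype.card α * ∑ φ : ι → α, (∑ j, c (φ j) • u (φ j)) ⬝ᵥ
          ((v φ ⬝ᵥ v φ) ^ r • v φ) := by
      simp only [dotProduct_smul, smul_eq_mul, pow_succ]
      rfl
    rw [h5, h1]
    refine (Finset.sum_le_sum fun j _ => h2 j).trans ?_
    rw [Finset.sum_comm, Finset.mul_sum]
    exact Finset.sum_le_sum fun φ _ => h3 φ
  exact le_of_mul_le_mul_left h4 (by positivity)

theorem exists_abs_dotProduct_mulVec_le {τ : Type*} [Fintype τ] [DecidableEq τ]
    {X : Matrix τ τ ℝ} (hX : X.IsHermitian) (p : ℕ) :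
    ∃ ρ : ℝ, 0 ≤ ρ ∧ ρ ^ (2 * p + 2) ≤ (X ^ (2 * p + 2)).trace ∧
      ∀ v, |v ⬝ᵥ (X *ᵥ v)| ≤ ρ * (v ⬝ᵥ v) := by
  obtain ⟨l, hl, hv⟩ := exists_trace_pow_and_dotProduct hX
  have he : Even (2 * p + 2) := by simp [parity_simps]
  rw [hl]
  rcases isEmpty_or_nonempty τ with h | h
  · exact ⟨0, le_rfl, by simp, fun v => by simp [dotProduct]⟩
  · obtain ⟨i, -, hi⟩ := Finset.exists_max_image Finset.univ (fun i => |l i|) Finset.univ_nonempty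
    refine ⟨|l i|, abs_nonneg _, ?_, fun v => ?_⟩
    · rw [he.pow_abs]
      exact Finset.single_le_sum (f := fun i => l i ^ (2 * p + 2))
        (fun j _ => he.pow_nonneg _) (Finset.mem_univ i)
    · obtain ⟨q, hq, h1, h2⟩ := hv v
      rw [h1, h2, Finset.mul_sum]
      refine (Finset.abs_sum_le_sum_abs _ _).trans (Finset.sum_le_sum fun j hj => ?_)
      rw [abs_mul, abs_of_nonneg (hq j)]
      exact mul_le_mul_of_nonneg_right (hi j hj) (hq j)

theorem sum_pow_mul_le {Φ : Type*} [Fintype Φ] (x ρ : Φ → ℝ) {m Q : ℝ} (hx : ∀ φ, 0 ≤ x φ)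
    (hρ : ∀ φ, 0 ≤ ρ φ) (hm : 0 < m) (hQ : 0 ≤ Q) (p : ℕ)
    (h : ∑ φ, ρ φ ^ (2 * p + 2) ≤ Fintype.card Φ * m ^ (2 * p + 2)) :
    Q * ∑ φ, (2 * m + ρ φ) * x φ ^ p ≤
      m * (3 * ∑ φ, x φ ^ (p + 1) + 4 * (Fintype.card Φ * Q ^ (p + 1))) := by
  have key : ∀ φ, Q * ((2 * m + ρ φ) * x φ ^ p) ≤
      m * (3 * x φ ^ (p + 1) + (3 + (ρ φ / m) ^ (2 * p + 2)) * Q ^ (p + 1)) := by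
    intro φ
    have hy : 0 ≤ ρ φ / m := div_nonneg (hρ φ) hm.le
    have a1 := pow_mul_pow_le_add (hx φ) hQ p 1
    have a2 := pow_mul_pow_le_add (hx φ) (mul_nonneg hy hQ) p 1
    have a3 := pow_mul_pow_le_add hy zero_le_one (p + 1) (p + 1)
    rw [one_pow, mul_one, one_pow, show p + 1 + (p + 1) = 2 * p + 2 by ring] at a3
    rw [mul_pow _ _ (p + 1)] at a2
    have a4 := mul_le_mul_of_nonneg_right a3 (pow_nonneg hQ (p + 1))
    have e : ρ φ = m * (ρ φ / m) := by field_simp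
    rw [e, show m * (ρ φ / m) / m = ρ φ / m by field_simp]
    rw [show Q * ((2 * m + m * (ρ φ / m)) * x φ ^ p) =
      m * (2 * (x φ ^ p * Q ^ 1) + x φ ^ p * (ρ φ / m * Q) ^ 1) by ring]
    refine mul_le_mul_of_nonneg_left ?_ hm.le
    linarith
  have h' : ∑ φ, (ρ φ / m) ^ (2 * p + 2) ≤ Fintype.card Φ := by
    simp only [div_pow, ← Finset.sum_div]
    rwa [div_le_iff₀ (by positivity)]
  calc _ = ∑ φ, Q * ((2 * m + ρ φ) * x φ ^ p) := Finset.mul_sum _ _ _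
    _ ≤ _ := Finset.sum_le_sum fun φ _ => key φ
    _ = m * (3 * ∑ φ, x φ ^ (p + 1) +
        (3 * Fintype.card Φ + ∑ φ, (ρ φ / m) ^ (2 * p + 2)) * Q ^ (p + 1)) := by
      simp only [← Finset.mul_sum, Finset.sum_add_distrib, ← Finset.sum_mul, Finset.sum_const,
        Finset.card_univ, nsmul_eq_mul]
      ring
    _ ≤ m * (3 * ∑ φ, x φ ^ (p + 1) +
        (3 * Fintype.card Φ + Fintype.card Φ) * Q ^ (p + 1)) := by gcongr
    _ = _ := by ring

theorem sum_trace_gramDev_pow_le_card {ι α τ : Type*} [Fintype ι] [DecidableEq ι] [Fintype α]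
    [Nonempty α] [Fintype τ] [DecidableEq τ] (u : α → τ → ℝ) {B : ℝ}
    (hB : ∀ k, u k ⬝ᵥ u k ≤ B)
    (hiso : ∑ k, vecMulVec (u k) (u k) = (Fintype.card α : ℝ) • (1 : Matrix τ τ ℝ)) (p : ℕ)
    (hp : 1088 * (p + 1) * B ≤ Fintype.card ι) (hτ : Fintype.card τ ≤ 64 ^ (p + 1)) :
    ∑ φ : ι → α, (gramDev u φ ^ (2 * p + 2)).trace ≤
      Fintype.card (ι → α) * (Fintype.card ι : ℝ) ^ (2 * p + 2) := by
  refine (sum_trace_gramDev_pow_le u hB hiso p hp).trans ?_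
  gcongr
  have hτ' : (Fintype.card τ : ℝ) ≤ 64 ^ (p + 1) := by exact_mod_cast hτ
  calc _ ≤ (64 : ℝ) ^ (p + 1) * ((Fintype.card ι : ℝ) / 8) ^ (2 * p + 2) := by gcongr
    _ = (Fintype.card ι : ℝ) ^ (2 * p + 2) := by
      rw [show 2 * p + 2 = 2 * (p + 1) by ring, pow_mul, ← mul_pow, pow_mul]
      congr 1; ring

/-- Moment bound for a sum of independent centred vectors `c k • u k`. -/
theorem sum_sampleVec_pow_le {ι α τ : Type*} [Fintype ι] [DecidableEq ι] [Nonempty ι] [Fintype α]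
    [Nonempty α] [Fintype τ] [DecidableEq τ] (c : α → ℝ) (u : α → τ → ℝ) {B D : ℝ}
    (hB : ∀ k, u k ⬝ᵥ u k ≤ B) (hD : ∀ k, c k ^ 2 ≤ D)
    (hiso : ∑ k, vecMulVec (u k) (u k) = (Fintype.card α : ℝ) • (1 : Matrix τ τ ℝ))
    (hc : ∑ k, c k ^ 2 = Fintype.card α) (hcu : ∑ k, c k • u k = 0) (p : ℕ)
    (hpB : 1088 * (p + 1) * B ≤ Fintype.card ι) (hpD : 1088 * (p + 1) * D ≤ Fintype.card ι)
    (hτ : Fintype.card τ ≤ 64 ^ (p + 1)) :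
    ∑ φ : ι → α, (sampleVec c u φ ⬝ᵥ sampleVec c u φ) ^ (p + 1) ≤
      Fintype.card (ι → α) * (12 * Fintype.card ι * (B + 4 * (p + 1) * D)) ^ (p + 1) := by
  set m : ℝ := (Fintype.card ι : ℝ) with hm
  have hm0 : 0 < m := by rw [hm]; exact_mod_cast Fintype.card_pos
  have hN : (0 : ℝ) < Fintype.card α := by exact_mod_cast Fintype.card_pos
  have hB0 : 0 ≤ B := (Finset.sum_nonneg fun i _ => mul_self_nonneg _).trans
    (hB (Classical.arbitrary α))
  have hD0 : 0 < D := by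
    by_contra hneg
    have : ∑ k, c k ^ 2 ≤ 0 := Finset.sum_nonpos fun k _ => (hD k).trans (not_lt.1 hneg)
    linarith
  choose ρ₂ h20 h2t h2v using fun φ : ι → α =>
    exists_abs_dotProduct_mulVec_le (gramDev_isHermitian u φ) p
  choose ρ₁ h10 h1t h1v using fun φ : ι → α =>
    exists_abs_dotProduct_mulVec_le (gramDev_isHermitian (fun k (_ : Unit) => c k) φ) p
  have hS : ∀ φ : ι → α, ∑ j, c (φ j) ^ 2 ≤ m + ρ₁ φ := by
    intro φ
    have := (le_abs_self _).trans (h1v φ 1)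
    simp [gramDev, dotProduct, mulVec, Matrix.sum_apply, vecMulVec_apply, ← pow_two] at this
    linarith
  set x : (ι → α) → ℝ := fun φ => sampleVec c u φ ⬝ᵥ sampleVec c u φ with hx
  have hx0 : ∀ φ, 0 ≤ x φ := fun φ => Finset.sum_nonneg fun i _ => mul_self_nonneg _
  set Q : ℝ := 12 * m * (B + 4 * (p + 1) * D) with hQ
  have hQ0 : 0 < Q := by positivity
  have b1 := sum_pow_mul_le x ρ₁ hx0 h10 hm0 hQ0.le p ((Finset.sum_le_sum fun φ _ => h1t φ).trans
    (sum_trace_gramDev_pow_le_card (B := D) _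
      (fun k => by simpa [dotProduct, ← pow_two] using hD k)
      (by ext i j; simp [Matrix.sum_apply, vecMulVec_apply, ← pow_two, hc]) p hpD
      (by simpa using Nat.one_le_pow _ _ (by norm_num))))
  have b2 := sum_pow_mul_le x ρ₂ hx0 h20 hm0 hQ0.le p ((Finset.sum_le_sum fun φ _ => h2t φ).trans
    (sum_trace_gramDev_pow_le_card u hB hiso p hpB hτ))
  set R : ℝ := Fintype.card (ι → α) * Q ^ (p + 1) with hR
  set b : ℝ := ∑ φ, x φ ^ (p + 1) with hb
  have hR0 : 0 ≤ R := by positivity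
  have hb0 : 0 ≤ b := Finset.sum_nonneg fun φ _ => pow_nonneg (hx0 φ) _
  have b3 : b ≤ B * ∑ φ, (2 * m + ρ₁ φ) * x φ ^ p +
      4 * (p + 1) * D * ∑ φ, (2 * m + ρ₂ φ) * x φ ^ p := by
    refine (sum_sampleVec_pow_le_sum c u hB hD hiso hc hcu p).trans ?_
    rw [Finset.mul_sum, Finset.mul_sum, ← Finset.sum_add_distrib]
    refine Finset.sum_le_sum fun φ _ => add_le_add ?_ ?_
    · rw [mul_assoc]
      have h3 : ∑ j, c (φ j) ^ 2 + m ≤ 2 * m + ρ₁ φ := by linarith [hS φ]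
      exact mul_le_mul_of_nonneg_left
        (mul_le_mul_of_nonneg_right h3 (pow_nonneg (hx0 φ) p)) hB0
    · rcases p with _ | p
      · have := h20 φ
        simp only [Nat.cast_zero, mul_zero, zero_mul, zero_add, mul_one, pow_zero]
        positivity
      · have h3 := (le_abs_self _).trans (h2v φ (sampleVec c u φ))
        have h4 : sampleVec c u φ ⬝ᵥ (gramDev u φ *ᵥ sampleVec c u φ) + 2 * m * x φ ≤
            (2 * m + ρ₂ φ) * x φ := by rw [add_mul]; linarith
        have h5 := hx0 φ
        have h6 := h20 φ
        rw [Nat.add_sub_cancel]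
        calc _ ≤ 4 * ((p + 1 : ℕ) : ℝ) * D * ((2 * m + ρ₂ φ) * x φ) * x φ ^ p := by gcongr
          _ = 4 * ((p + 1 : ℕ) : ℝ) * D * ((2 * m + ρ₂ φ) * x φ ^ (p + 1)) := by ring
          _ ≤ _ := by gcongr; linarith
  have b4 : Q * b ≤ Q * ((3 * b + 4 * R) / 12) := by
    calc _ ≤ Q * (B * ∑ φ, (2 * m + ρ₁ φ) * x φ ^ p +
          4 * (p + 1) * D * ∑ φ, (2 * m + ρ₂ φ) * x φ ^ p) := by gcongr
      _ = B * (Q * ∑ φ, (2 * m + ρ₁ φ) * x φ ^ p) +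
          4 * (p + 1) * D * (Q * ∑ φ, (2 * m + ρ₂ φ) * x φ ^ p) := by ring
      _ ≤ B * (m * (3 * b + 4 * R)) + 4 * (p + 1) * D * (m * (3 * b + 4 * R)) := by gcongr
      _ = _ := by rw [hQ]; ring
  have b5 := le_of_mul_le_mul_left b4 hQ0
  linarith

theorem sum_image_perm_eq {α : Type*} [Fintype α] [DecidableEq α] (f : Finset α → ℝ)
    {s t : Finset α} (h : s.card = t.card) :
    ∑ σ : Equiv.Perm α, f (s.image σ) = ∑ σ : Equiv.Perm α, f (t.image σ) := by
  obtain ⟨e⟩ : Nonempty ({x // x ∈ s} ≃ {x // x ∈ t}) := ⟨Finset.equivOfCardEq h⟩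
  have ht : t = s.image e.extendSubtype := by
    symm
    apply Finset.eq_of_subset_of_card_le
    · intro x hx
      obtain ⟨y, hy, rfl⟩ := Finset.mem_image.1 hx
      exact Equiv.extendSubtype_mem e y hy
    · rw [Finset.card_image_of_injective _ (Equiv.injective _), h]
  rw [ht]
  simp only [Finset.image_image, ← Equiv.Perm.coe_mul]
  exact (Equiv.sum_comp (Equiv.mulRight e.extendSubtype) fun σ => f (s.image σ)).symm

/-- Sampling without replacement is at least as good as sampling with replacement for antitone
quantities. -/
theorem sum_powersetCard_le_sum_image {α ι : Type*} [Fintype α] [DecidableEq α] [Fintype ι]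
    [DecidableEq ι] (f : Finset α → ℝ) (hf : Antitone f) (h : Fintype.card ι ≤ Fintype.card α) :
    (Fintype.card (ι → α) : ℝ) *
        ∑ s ∈ Finset.powersetCard (Fintype.card ι) (Finset.univ : Finset α), f s ≤
      (Finset.powersetCard (Fintype.card ι) (Finset.univ : Finset α)).card *
        ∑ φ : ι → α, f (Finset.univ.image φ) := by
  obtain ⟨s₀, -, hs₀⟩ := Finset.exists_subset_card_eq (s := (Finset.univ : Finset α)) h
  set A : ℝ := ∑ σ : Equiv.Perm α, f (s₀.image σ) with hA
  have hP : (0 : ℝ) < Fintype.card (Equiv.Perm α) := by exact_mod_cast Fintype.card_pos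
  have h1 : (Fintype.card (Equiv.Perm α) : ℝ) *
      ∑ s ∈ Finset.powersetCard (Fintype.card ι) (Finset.univ : Finset α), f s =
      (Finset.powersetCard (Fintype.card ι) (Finset.univ : Finset α)).card * A := by
    have e1 : ∀ σ : Equiv.Perm α,
        ∑ s ∈ Finset.powersetCard (Fintype.card ι) (Finset.univ : Finset α), f (s.image σ) =
        ∑ s ∈ Finset.powersetCard (Fintype.card ι) (Finset.univ : Finset α), f s := by
      intro σ
      refine Finset.sum_bij' (fun s _ => s.image σ) (fun s _ => s.image σ.symm) ?_ ?_ ?_ ?_ ?_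
      · intro s hs
        rw [Finset.mem_powersetCard_univ] at hs ⊢
        rw [Finset.card_image_of_injective _ σ.injective, hs]
      · intro s hs
        rw [Finset.mem_powersetCard_univ] at hs ⊢
        rw [Finset.card_image_of_injective _ σ.symm.injective, hs]
      · intro s _; simp [Finset.image_image]
      · intro s _; simp [Finset.image_image]
      · intro s _; rfl
    calc _ = ∑ σ : Equiv.Perm α,
        ∑ s ∈ Finset.powersetCard (Fintype.card ι) (Finset.univ : Finset α), f (s.image σ) := by
          simp [e1]
      _ = ∑ s ∈ Finset.powersetCard (Fintype.card ι) (Finset.univ : Finset α), A := by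
          rw [Finset.sum_comm]
          refine Finset.sum_congr rfl fun s hs => sum_image_perm_eq f ?_
          rw [Finset.mem_powersetCard_univ.1 hs, hs₀]
      _ = _ := by simp
  have h2 : (Fintype.card (ι → α) : ℝ) * A ≤
      Fintype.card (Equiv.Perm α) * ∑ φ : ι → α, f (Finset.univ.image φ) := by
    have e1 : ∀ φ : ι → α, A ≤ ∑ σ : Equiv.Perm α, f (Finset.univ.image (σ ∘ φ)) := by
      intro φ
      obtain ⟨s, hs, hc⟩ := Finset.exists_superset_card_eq
        (s := Finset.univ.image φ) (n := Fintype.card ι) Finset.card_image_le h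
      rw [hA, sum_image_perm_eq f (hs₀.trans hc.symm)]
      refine Finset.sum_le_sum fun σ _ => hf ?_
      rw [← Finset.image_image]
      exact Finset.image_subset_image hs
    calc _ = ∑ φ : ι → α, A := by simp
      _ ≤ ∑ φ : ι → α, ∑ σ : Equiv.Perm α, f (Finset.univ.image (σ ∘ φ)) :=
          Finset.sum_le_sum fun φ _ => e1 φ
      _ = ∑ σ : Equiv.Perm α, ∑ φ : ι → α, f (Finset.univ.image φ) := by
          rw [Finset.sum_comm]
          refine Finset.sum_congr rfl fun σ _ => ?_
          exact Equiv.sum_comp ((Equiv.refl ι).arrowCongr σ) fun φ => f (Finset.univ.image φ)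
      _ = _ := by simp
  refine le_of_mul_le_mul_left ?_ hP
  calc _ = (Fintype.card (ι → α) : ℝ) * (Fintype.card (Equiv.Perm α) *
      ∑ s ∈ Finset.powersetCard (Fintype.card ι) (Finset.univ : Finset α), f s) := by ring
    _ = (Finset.powersetCard (Fintype.card ι) (Finset.univ : Finset α)).card *
        (Fintype.card (ι → α) * A) := by rw [h1]; ring
    _ ≤ (Finset.powersetCard (Fintype.card ι) (Finset.univ : Finset α)).card *
        (Fintype.card (Equiv.Perm α) * ∑ φ : ι → α, f (Finset.univ.image φ)) := by gcongr
    _ = _ := by ring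

/-- The real sign encoded by a Boolean. -/
noncomputable def boolSign (b : Bool) : ℝ := if b then 1 else -1

theorem sum_exp_dotProduct_boolSign_le {τ : Type*} [Fintype τ] [DecidableEq τ] (w : τ → ℝ) :
    ∑ z : τ → Bool, exp (w ⬝ᵥ fun i => boolSign (z i)) ≤
      2 ^ Fintype.card τ * exp ((w ⬝ᵥ w) / 2) := by
  have h1 : ∑ z : τ → Bool, exp (w ⬝ᵥ fun i => boolSign (z i)) =
      ∏ i, ∑ b : Bool, exp (w i * boolSign b) := by
    rw [Finset.prod_univ_sum, Fintype.piFinset_univ]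
    simp only [dotProduct, exp_sum]
  rw [h1]
  calc _ ≤ ∏ i, (2 * exp (w i ^ 2 / 2)) := by
        refine Finset.prod_le_prod (fun i _ => Finset.sum_nonneg fun b _ => (exp_pos _).le)
          fun i _ => ?_
        have := cosh_le_exp_half_sq (w i)
        rw [cosh_eq] at this
        simp [boolSign]
        linarith
    _ = _ := by
      rw [Finset.prod_mul_distrib, ← exp_sum]
      simp [dotProduct, Finset.sum_div, pow_two]

theorem card_filter_mul_le_sum {Φ : Type*} [Fintype Φ] (g : Φ → ℝ) (hg : ∀ φ, 0 ≤ g φ) (a : ℝ)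
    (P : Φ → Prop) [DecidablePred P] (hP : ∀ φ, P φ → a ≤ g φ) :
    ((Finset.univ.filter P).card : ℝ) * a ≤ ∑ φ, g φ := by
  calc _ = ∑ φ ∈ Finset.univ.filter P, a := by simp
    _ ≤ ∑ φ ∈ Finset.univ.filter P, g φ :=
        Finset.sum_le_sum fun φ hφ => hP φ (Finset.mem_filter.1 hφ).2
    _ ≤ _ := Finset.sum_le_sum_of_subset_of_nonneg (Finset.filter_subset _ _)
        fun φ _ _ => hg φ

/-- Hoeffding's inequality for a Rademacher sum. -/
theorem card_filter_one_le_abs_dotProduct_le {τ : Type*} [Fintype τ] [DecidableEq τ] (w : τ → ℝ)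
    {b : ℝ} (hb : 0 < b) (hw : w ⬝ᵥ w ≤ b) :
    ((Finset.univ.filter fun z : τ → Bool => 1 ≤ |w ⬝ᵥ fun i => boolSign (z i)|).card : ℝ) ≤
      2 ^ Fintype.card τ * (2 * exp (-1 / (2 * b))) := by
  have h := card_filter_mul_le_sum
    (fun z : τ → Bool => exp ((b⁻¹ • w) ⬝ᵥ fun i => boolSign (z i)) +
      exp ((-b⁻¹ • w) ⬝ᵥ fun i => boolSign (z i))) (fun z => by positivity) (exp b⁻¹)
    (fun z : τ → Bool => 1 ≤ |w ⬝ᵥ fun i => boolSign (z i)|) (fun z hz => by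
      have hb' := inv_pos.2 hb
      rw [smul_dotProduct, smul_dotProduct, smul_eq_mul, smul_eq_mul]
      rcases le_abs.1 hz with h | h
      · have : exp b⁻¹ ≤ exp (b⁻¹ * (w ⬝ᵥ fun i => boolSign (z i))) :=
          exp_le_exp.2 (by nlinarith)
        have := exp_pos (-b⁻¹ * (w ⬝ᵥ fun i => boolSign (z i)))
        linarith
      · have : exp b⁻¹ ≤ exp (-b⁻¹ * (w ⬝ᵥ fun i => boolSign (z i))) :=
          exp_le_exp.2 (by nlinarith)
        have := exp_pos (b⁻¹ * (w ⬝ᵥ fun i => boolSign (z i)))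
        linarith)
  rw [Finset.sum_add_distrib] at h
  have e : ∀ c : ℝ, c ^ 2 = (b⁻¹) ^ 2 → ∑ z : τ → Bool,
      exp ((c • w) ⬝ᵥ fun i => boolSign (z i)) ≤ 2 ^ Fintype.card τ * exp (1 / (2 * b)) := by
    intro c hc
    refine (sum_exp_dotProduct_boolSign_le _).trans ?_
    refine mul_le_mul_of_nonneg_left (exp_le_exp.2 ?_) (by positivity)
    rw [smul_dotProduct, dotProduct_smul, smul_eq_mul, smul_eq_mul, ← mul_assoc, ← pow_two, hc]
    calc _ ≤ b⁻¹ ^ 2 * b / 2 := by gcongr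
      _ = _ := by field_simp
  have e1 := e b⁻¹ rfl
  have e2 := e (-b⁻¹) (neg_sq _)
  have e3 : exp (-1 / (2 * b)) * exp b⁻¹ = exp (1 / (2 * b)) := by
    rw [← exp_add]; congr 1; field_simp; ring
  refine le_of_mul_le_mul_right ?_ (exp_pos b⁻¹)
  calc _ ≤ _ := h
    _ ≤ 2 ^ Fintype.card τ * exp (1 / (2 * b)) + 2 ^ Fintype.card τ * exp (1 / (2 * b)) :=
        add_le_add e1 e2
    _ = _ := by rw [← e3]; ring

/-- Every `x0` supported on `T` with sign pattern `z` is the unique `ℓ₁`-minimizer among the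
vectors whose measurements on `Ω` agree with those of `x0`. -/
def Recovers {n : ℕ} (U : Matrix (Fin n) (Fin n) ℝ) (T Ω : Finset (Fin n)) (z : ↥T → Bool) :
    Prop :=
  ∀ x0 : Fin n → ℝ,
    (∀ t, t ∉ T → x0 t = 0) →
    (∀ t (ht : t ∈ T), Real.sign (x0 t) = (if z ⟨t, ht⟩ then 1 else -1)) →
    ∀ x : Fin n → ℝ, (∀ k ∈ Ω, U.mulVec x k = U.mulVec x0 k) → x ≠ x0 →
      ∑ i, |x0 i| < ∑ i, |x i|

theorem Recovers.mono {n : ℕ} {U : Matrix (Fin n) (Fin n) ℝ} {T Ω Ω' : Finset (Fin n)}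
    {z : ↥T → Bool} (h : Recovers U T Ω z) (hΩ : Ω ⊆ Ω') : Recovers U T Ω' z :=
  fun x0 h0 hs x hx hne => h x0 h0 hs x (fun k hk => hx k (hΩ hk)) hne

theorem recovers_of_dual {n : ℕ} {U : Matrix (Fin n) (Fin n) ℝ} {T Ω : Finset (Fin n)}
    {z : ↥T → Bool} (q : Fin n → ℝ)
    (hq : ∀ h, (∀ k ∈ Ω, (U *ᵥ h) k = 0) → q ⬝ᵥ h = 0)
    (hT : ∀ t (ht : t ∈ T), q t = boolSign (z ⟨t, ht⟩)) (hTc : ∀ t, t ∉ T → |q t| < 1)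
    (hinj : ∀ h, (∀ k ∈ Ω, (U *ᵥ h) k = 0) → (∀ t, t ∉ T → h t = 0) → h = 0) :
    Recovers U T Ω z := by
  intro x0 h0 hs x hx hne
  have hker : ∀ k ∈ Ω, (U *ᵥ (x - x0)) k = 0 := fun k hk => by
    rw [mulVec_sub, Pi.sub_apply, hx k hk, sub_self]
  obtain ⟨t, ht, hxt⟩ : ∃ t, t ∉ T ∧ (x - x0) t ≠ 0 := by
    by_contra! hc
    exact hne (sub_eq_zero.1 (hinj _ hker hc))
  have hoff : ∀ t, t ∉ T → (x - x0) t ≠ 0 → |x0 t| + q t * (x - x0) t < |x t| := by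
    intro t ht hxt
    rw [Pi.sub_apply, h0 t ht, sub_zero] at hxt
    rw [Pi.sub_apply, h0 t ht, sub_zero, abs_zero, zero_add]
    calc _ ≤ |q t * x t| := le_abs_self _
      _ = |q t| * |x t| := abs_mul _ _
      _ < _ := mul_lt_of_lt_one_left (abs_pos.2 hxt) (hTc t ht)
  have hle : ∀ t, |x0 t| + q t * (x - x0) t ≤ |x t| := by
    intro t
    by_cases ht : t ∈ T
    · have hst := hs t ht
      rw [hT t ht, Pi.sub_apply, boolSign]
      rcases lt_trichotomy (x0 t) 0 with h | h | h
      · rw [Real.sign_of_neg h] at hst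
        rw [← hst, abs_of_neg h]
        linarith [neg_abs_le (x t)]
      · rw [h, Real.sign_zero] at hst
        split_ifs at hst <;> norm_num at hst
      · rw [Real.sign_of_pos h] at hst
        rw [← hst, abs_of_pos h]
        linarith [le_abs_self (x t)]
    · by_cases hxt : (x - x0) t = 0
      · rw [hxt, mul_zero, add_zero, sub_eq_zero.1 hxt]
      · exact (hoff t ht hxt).le
  calc ∑ i, |x0 i| = ∑ i, (|x0 i| + q i * (x - x0) i) := by
        rw [Finset.sum_add_distrib]
        have := hq _ hker
        rw [dotProduct] at this
        rw [this, add_zero]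
    _ < _ := Finset.sum_lt_sum (fun i _ => hle i) ⟨t, Finset.mem_univ _, hoff t ht hxt⟩

/-- The row of `U` with index `k`, restricted to the columns in `T`. -/
def rowOn {n : ℕ} (U : Matrix (Fin n) (Fin n) ℝ) (T : Finset (Fin n)) (k : Fin n) : ↥T → ℝ :=
  fun t => U k t

theorem sum_vecMulVec_mulVec {ι τ : Type*} [Fintype ι] [Fintype τ] [DecidableEq τ]
    (v : ι → τ → ℝ) (y : τ → ℝ) :
    (∑ j, vecMulVec (v j) (v j)) *ᵥ y = ∑ j, (v j ⬝ᵥ y) • v j := by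
  ext t
  simp only [sum_mulVec, vecMulVec_mulVec, Finset.sum_apply, Pi.smul_apply, op_smul_eq_smul]

/-- If the sampled Gram matrix is well conditioned and the vectors `G⁻¹ v` are nearly orthogonal
to the signs, the sampled rows recover the sign pattern. -/
theorem recovers_image {n m : ℕ} {U : Matrix (Fin n) (Fin n) ℝ} {T : Finset (Fin n)} (hm : 0 < m)
    (φ : Fin m → Fin n)
    (hφ : ∀ v, |v ⬝ᵥ (gramDev (rowOn U T) φ *ᵥ v)| ≤ (m / 2 : ℝ) * (v ⬝ᵥ v)) :
    ∃ w : Fin n → ↥T → ℝ,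
      (∀ t, (w t ⬝ᵥ w t) * m ^ 2 ≤
        4 * (sampleVec (fun k => U k t) (rowOn U T) φ ⬝ᵥ
          sampleVec (fun k => U k t) (rowOn U T) φ)) ∧
      ∀ z : ↥T → Bool, (∀ t, t ∉ T → |w t ⬝ᵥ fun i => boolSign (z i)| < 1) →
        Recovers U T (Finset.univ.image φ) z := by
  have hm' : (0 : ℝ) < m := by exact_mod_cast hm
  set u := rowOn U T with hu
  set G : Matrix ↥T ↥T ℝ := ∑ j, vecMulVec (u (φ j)) (u (φ j)) with hG
  have hGv : ∀ v, (m / 2 : ℝ) * (v ⬝ᵥ v) ≤ v ⬝ᵥ (G *ᵥ v) := by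
    intro v
    have h1 : G = gramDev u φ + (m : ℝ) • 1 := by simp [gramDev, hG]
    have := (abs_le.1 (hφ v)).1
    rw [h1, add_mulVec, dotProduct_add, smul_mulVec, one_mulVec, dotProduct_smul, smul_eq_mul]
    linarith
  have hzero : ∀ v, G *ᵥ v = 0 → v = 0 := by
    intro v hv
    have h1 := hGv v
    rw [hv, dotProduct_zero] at h1
    have h2 : v ⬝ᵥ v = 0 := le_antisymm (by nlinarith)
      (Finset.sum_nonneg fun _ _ => mul_self_nonneg _)
    exact dotProduct_self_eq_zero.1 h2
  have hdet : IsUnit G.det := by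
    rw [isUnit_iff_ne_zero]
    intro h
    obtain ⟨v, hv, h⟩ := exists_mulVec_eq_zero_iff.2 h
    exact hv (hzero v h)
  have hsymm : Gᵀ = G := by
    rw [hG, transpose_sum]
    exact Finset.sum_congr rfl fun j _ => by rw [transpose_vecMulVec]
  have hinv : (G⁻¹)ᵀ = G⁻¹ := by rw [transpose_nonsing_inv, hsymm]
  refine ⟨fun t => G⁻¹ *ᵥ sampleVec (fun k => U k t) u φ, ?_, ?_⟩
  · intro t
    set v := sampleVec (fun k => U k t) u φ
    set w := G⁻¹ *ᵥ v with hw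
    have hGw : G *ᵥ w = v := by rw [hw, mulVec_mulVec, mul_nonsing_inv _ hdet, one_mulVec]
    have h1 := hGv w
    rw [hGw] at h1
    have h2 : 0 ≤ (v - (m / 2 : ℝ) • w) ⬝ᵥ (v - (m / 2 : ℝ) • w) :=
      Finset.sum_nonneg fun _ _ => mul_self_nonneg _
    simp only [sub_dotProduct, dotProduct_sub, smul_dotProduct, dotProduct_smul, smul_eq_mul,
      dotProduct_comm v w] at h2
    have h3 : 0 ≤ v ⬝ᵥ v := Finset.sum_nonneg fun _ _ => mul_self_nonneg _
    nlinarith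
  · intro z hz
    set s : ↥T → ℝ := fun i => boolSign (z i) with hs
    set y := G⁻¹ *ᵥ s with hy
    have hGy : G *ᵥ y = s := by rw [hy, mulVec_mulVec, mul_nonsing_inv _ hdet, one_mulVec]
    have hq : ∀ t, ∑ j, U (φ j) t * (u (φ j) ⬝ᵥ y) =
        sampleVec (fun k => U k t) u φ ⬝ᵥ y := by
      intro t
      simp [sampleVec, sum_dotProduct]
    refine recovers_of_dual (fun t => ∑ j, U (φ j) t * (u (φ j) ⬝ᵥ y)) ?_ ?_ ?_ ?_
    · intro h hh
      simp only [dotProduct, Finset.sum_mul]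
      rw [Finset.sum_comm]
      refine Finset.sum_eq_zero fun j _ => ?_
      have := hh (φ j) (Finset.mem_image_of_mem _ (Finset.mem_univ _))
      rw [mulVec, dotProduct] at this
      calc _ = (∑ i, U (φ j) i * h i) * (u (φ j) ⬝ᵥ y) := by
            rw [Finset.sum_mul]
            exact Finset.sum_congr rfl fun i _ => by rw [dotProduct]; ring
        _ = 0 := by rw [this, zero_mul]
    · intro t ht
      have := congrFun hGy ⟨t, ht⟩
      rw [hG, sum_vecMulVec_mulVec, Finset.sum_apply] at this
      rw [show boolSign (z ⟨t, ht⟩) = s ⟨t, ht⟩ from rfl, ← this]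
      exact Finset.sum_congr rfl fun j _ => by simp [hu, rowOn, mul_comm]
    · intro t ht
      have := hz t ht
      rw [hq t, hy, dotProduct_mulVec, ← mulVec_transpose, hinv]
      exact this
    · intro h hh hT
      have hG0 : G *ᵥ (fun i : ↥T => h i) = 0 := by
        rw [hG, sum_vecMulVec_mulVec]
        refine Finset.sum_eq_zero fun j _ => ?_
        have h1 := hh (φ j) (Finset.mem_image_of_mem _ (Finset.mem_univ _))
        have h2 : u (φ j) ⬝ᵥ (fun i : ↥T => h i) = (U *ᵥ h) (φ j) := by
          simp only [hu, rowOn, mulVec, dotProduct]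
          rw [Finset.sum_coe_sort T fun i => U (φ j) i * h i]
          exact Finset.sum_subset (Finset.subset_univ _) fun i _ hi => by rw [hT i hi, mul_zero]
        rw [h2, h1, zero_smul]
      have h0 := hzero _ hG0
      ext t
      by_cases ht : t ∈ T
      · exact congrFun h0 ⟨t, ht⟩
      · exact hT t ht

theorem card_filter_one_le_of_energy_le {τ : Type*} [Fintype τ] [DecidableEq τ] {w : τ → ℝ}
    {D q m : ℝ} (hq : 0 < q) (hm : 0 < m) (hD : 0 ≤ D)
    (hw : (w ⬝ᵥ w) * m ≤ 768 * (D * (Fintype.card τ + 4 * q)))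
    (hmD : 20000 * q * (Fintype.card τ * D) ≤ m) :
    ((Finset.univ.filter fun z : τ → Bool => 1 ≤ |w ⬝ᵥ fun i => boolSign (z i)|).card : ℝ) ≤
      2 ^ Fintype.card τ * (2 * exp (-(2 * q))) := by
  set k : ℝ := (Fintype.card τ : ℝ) with hk
  have hk0 : 0 ≤ k := Nat.cast_nonneg _
  rcases le_or_gt k q with h | h
  · rw [Finset.filter_false_of_mem, Finset.card_empty, Nat.cast_zero]
    · positivity
    · intro z _
      rw [not_le, ← sq_lt_one_iff_abs_lt_one]
      have hcs : (w ⬝ᵥ fun i => boolSign (z i)) ^ 2 ≤ (w ⬝ᵥ w) * k := by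
        have := Finset.sum_mul_sq_le_sq_mul_sq Finset.univ w fun i => boolSign (z i)
        have hs : ∑ i, boolSign (z i) ^ 2 = k := by
          rw [hk, ← nsmul_one, ← Finset.card_univ, ← Finset.sum_const]
          exact Finset.sum_congr rfl fun i _ => by unfold boolSign; split_ifs <;> norm_num
        rw [hs] at this
        simpa [dotProduct, pow_two] using this
      refine lt_of_mul_lt_mul_right ?_ hm.le
      calc _ ≤ (w ⬝ᵥ w) * k * m := by gcongr
        _ = (w ⬝ᵥ w) * m * k := by ring
        _ ≤ 768 * (D * (k + 4 * q)) * k := by gcongr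
        _ ≤ 768 * (D * (q + 4 * q)) * k := by gcongr
        _ = 3840 / 20000 * (20000 * q * (k * D)) := by ring
        _ ≤ 3840 / 20000 * m := by gcongr
        _ < 1 * m := by gcongr; norm_num
  · have hb : w ⬝ᵥ w ≤ 1 / (4 * q) := by
      rw [le_div_iff₀ (by positivity)]
      refine le_of_mul_le_mul_right ?_ hm
      calc _ = (w ⬝ᵥ w) * m * (4 * q) := by ring
        _ ≤ 768 * (D * (k + 4 * q)) * (4 * q) := by gcongr
        _ ≤ 768 * (D * (k + 4 * k)) * (4 * q) := by gcongr
        _ = 15360 / 20000 * (20000 * q * (k * D)) := by ring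
        _ ≤ 15360 / 20000 * m := by gcongr
        _ ≤ 1 * m := by gcongr; norm_num
    refine (card_filter_one_le_abs_dotProduct_le w (by positivity) hb).trans_eq ?_
    congr 3
    field_simp
    norm_num

theorem sum_mul_eq_of_transpose_mul_self {n : ℕ} {U : Matrix (Fin n) (Fin n) ℝ}
    (hU : Uᵀ * U = (n : ℝ) • (1 : Matrix (Fin n) (Fin n) ℝ)) (i j : Fin n) :
    ∑ k, U k i * U k j = if i = j then (n : ℝ) else 0 := by
  have := congrFun (congrFun hU i) j
  simpa [mul_apply, one_apply] using this

theorem card_filter_not_bounded_le {ι α τ : Type*} [Fintype ι] [DecidableEq ι] [Nonempty ι]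
    [Fintype α] [Nonempty α] [Fintype τ] [DecidableEq τ] (u : α → τ → ℝ) {B : ℝ}
    (hB : ∀ k, u k ⬝ᵥ u k ≤ B)
    (hiso : ∑ k, vecMulVec (u k) (u k) = (Fintype.card α : ℝ) • (1 : Matrix τ τ ℝ)) (p : ℕ)
    (hp : 1088 * (p + 1) * B ≤ Fintype.card ι) :
    ((Finset.univ.filter fun φ : ι → α =>
      ¬ ∀ v, |v ⬝ᵥ (gramDev u φ *ᵥ v)| ≤ (Fintype.card ι / 2 : ℝ) * (v ⬝ᵥ v)).card : ℝ) *
        16 ^ (p + 1) ≤ Fintype.card (ι → α) * Fintype.card τ := by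
  have hι : (0 : ℝ) < Fintype.card ι := by exact_mod_cast Fintype.card_pos
  have h := card_filter_mul_le_sum (fun φ : ι → α => (gramDev u φ ^ (2 * p + 2)).trace)
    (fun φ => ?_) ((Fintype.card ι / 2 : ℝ) ^ (2 * p + 2))
    (fun φ => ¬ ∀ v, |v ⬝ᵥ (gramDev u φ *ᵥ v)| ≤ (Fintype.card ι / 2 : ℝ) * (v ⬝ᵥ v))
    (fun φ hφ => ?_)
  · have h2 := h.trans (sum_trace_gramDev_pow_le u hB hiso p hp)
    have h3 : (Fintype.card ι / 2 : ℝ) ^ (2 * p + 2) =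
        16 ^ (p + 1) * (Fintype.card ι / 8 : ℝ) ^ (2 * p + 2) := by
      rw [show 2 * p + 2 = 2 * (p + 1) by ring, pow_mul, pow_mul, ← mul_pow]
      congr 1
      ring
    refine le_of_mul_le_mul_right ?_ (show (0 : ℝ) < (Fintype.card ι / 8 : ℝ) ^ (2 * p + 2) by
      positivity)
    rw [h3] at h2
    linarith
  · obtain ⟨ρ, h0, h1, -⟩ := exists_abs_dotProduct_mulVec_le (gramDev_isHermitian u φ) p
    exact (pow_nonneg h0 _).trans h1
  · obtain ⟨ρ, h0, h1, h2⟩ := exists_abs_dotProduct_mulVec_le (gramDev_isHermitian u φ) p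
    refine le_trans (pow_le_pow_left₀ (by positivity) ?_ _) h1
    by_contra! hc
    refine hφ fun v => (h2 v).trans ?_
    exact mul_le_mul_of_nonneg_right hc.le (Finset.sum_nonneg fun _ _ => mul_self_nonneg _)


/-- Averaged over the sample points and the signs, recovery fails with exponentially small
probability. -/
theorem sum_card_not_recovers_le {n m : ℕ} {U : Matrix (Fin n) (Fin n) ℝ}
    (hU : Uᵀ * U = (n : ℝ) • (1 : Matrix (Fin n) (Fin n) ℝ)) {T : Finset (Fin n)}
    (hT : T.Nonempty) (hm : 0 < m) {D : ℝ} (hD : ∀ k j, U k j ^ 2 ≤ D) (p : ℕ)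
    (hmD : 20000 * (p + 1) * (T.card * D) ≤ m) (hn : n ≤ 64 ^ (p + 1)) :
    ∑ φ : Fin m → Fin n,
        ((Finset.univ.filter fun z => ¬ Recovers U T (Finset.univ.image φ) z).card : ℝ) ≤
      Fintype.card (Fin m → Fin n) * 2 ^ T.card * (3 * n * exp (-(2 * (p + 1)))) := by
  obtain ⟨t₀, ht₀⟩ := hT
  have : Nonempty (Fin n) := ⟨t₀⟩
  have : Nonempty (Fin m) := ⟨⟨0, hm⟩⟩
  have hm' : (0 : ℝ) < m := by exact_mod_cast hm
  have hn0 : (0 : ℝ) < n := by exact_mod_cast t₀.pos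
  have hT1 : (1 : ℝ) ≤ T.card := by exact_mod_cast Finset.card_pos.2 ⟨t₀, ht₀⟩
  have hTn : (T.card : ℝ) ≤ n := by
    exact_mod_cast (Finset.card_le_univ T).trans_eq (Fintype.card_fin n)
  have hD0 : 0 < D := by
    by_contra! hc
    have := sum_mul_eq_of_transpose_mul_self hU t₀ t₀
    rw [if_pos rfl] at this
    have h2 : ∑ k, U k t₀ * U k t₀ ≤ 0 :=
      Finset.sum_nonpos fun k _ => by have := hD k t₀; nlinarith
    linarith
  set u := rowOn U T with hu
  have hB : ∀ k, u k ⬝ᵥ u k ≤ T.card * D := by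
    intro k
    calc _ ≤ ∑ _i : ↥T, D := Finset.sum_le_sum fun i _ => by
          have := hD k i
          simp only [hu, rowOn]
          nlinarith
      _ = _ := by simp
  have hiso : ∑ k, vecMulVec (u k) (u k) =
      (Fintype.card (Fin n) : ℝ) • (1 : Matrix ↥T ↥T ℝ) := by
    ext i j
    have := sum_mul_eq_of_transpose_mul_self hU (i : Fin n) j
    simp only [Matrix.sum_apply, vecMulVec_apply, hu, rowOn, this, Fintype.card_fin,
      Matrix.smul_apply, one_apply, Subtype.ext_iff, smul_eq_mul]
    split_ifs <;> simp
  have hpB : 1088 * ((p : ℝ) + 1) * (T.card * D) ≤ Fintype.card (Fin m) := by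
    rw [Fintype.card_fin]
    refine le_trans ?_ hmD
    gcongr
    norm_num
  have hpD : 1088 * ((p : ℝ) + 1) * D ≤ Fintype.card (Fin m) := by
    refine le_trans ?_ hpB
    gcongr
    exact le_mul_of_one_le_left hD0.le hT1
  have hτ : Fintype.card ↥T ≤ 64 ^ (p + 1) := by
    refine le_trans ?_ hn
    rw [Fintype.card_coe]
    exact_mod_cast hTn
  set Q : ℝ := 12 * m * (T.card * D + 4 * (p + 1) * D) with hQ
  have hQ0 : 0 < Q := by positivity
  set N : ℝ := (Fintype.card (Fin m → Fin n) : ℝ) with hN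
  set v : Fin n → (Fin m → Fin n) → ↥T → ℝ :=
    fun t φ => sampleVec (fun k => U k t) u φ with hv
  let P1 : (Fin m → Fin n) → Prop := fun φ =>
    ¬ ∀ v, |v ⬝ᵥ (gramDev u φ *ᵥ v)| ≤ (m / 2 : ℝ) * (v ⬝ᵥ v)
  let P2 : Fin n → (Fin m → Fin n) → Prop := fun t φ => 16 * Q ≤ v t φ ⬝ᵥ v t φ
  have hP1 : ((Finset.univ.filter P1).card : ℝ) * 16 ^ (p + 1) ≤ N * T.card := by
    have := card_filter_not_bounded_le (ι := Fin m) u hB hiso p hpB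
    rw [Fintype.card_coe, Fintype.card_fin m] at this
    exact this
  have hP2 : ∀ t, t ∉ T → ((Finset.univ.filter (P2 t)).card : ℝ) * 16 ^ (p + 1) ≤ N := by
    intro t ht
    have h1 := sum_sampleVec_pow_le (ι := Fin m) (fun k => U k t) u hB (fun k => hD k t) hiso
      (by simpa [pow_two] using sum_mul_eq_of_transpose_mul_self hU t t)
      (by
        ext i
        have := sum_mul_eq_of_transpose_mul_self hU t i
        rw [if_neg (fun h : t = i => ht (h ▸ i.2))] at this
        simpa [hu, rowOn] using this) p hpB hpD hτ
    rw [Fintype.card_fin m] at h1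
    have h2 := card_filter_mul_le_sum
      (fun φ => (v t φ ⬝ᵥ v t φ) ^ (p + 1))
      (fun φ => pow_nonneg (Finset.sum_nonneg fun _ _ => mul_self_nonneg _) _)
      ((16 * Q) ^ (p + 1)) (P2 t) (fun φ hφ => pow_le_pow_left₀ (by positivity) hφ _)
    refine le_of_mul_le_mul_right ?_ (pow_pos hQ0 (p + 1))
    rw [mul_assoc, ← mul_pow]
    exact h2.trans h1
  have hpt : ∀ φ : Fin m → Fin n,
      ((Finset.univ.filter fun z => ¬ Recovers U T (Finset.univ.image φ) z).card : ℝ) ≤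
        2 ^ T.card * ((if P1 φ then 1 else 0) + ∑ t ∈ Tᶜ, (if P2 t φ then 1 else 0) +
          n * (2 * exp (-(2 * (p + 1))))) := by
    intro φ
    have htriv : ((Finset.univ.filter fun z =>
        ¬ Recovers U T (Finset.univ.image φ) z).card : ℝ) ≤ 2 ^ T.card := by
      have := Finset.card_le_univ
        (Finset.univ.filter fun z => ¬ Recovers U T (Finset.univ.image φ) z)
      simp only [Fintype.card_fun, Fintype.card_bool, Fintype.card_coe] at this
      exact_mod_cast this
    have hs0 : ∀ t ∈ Tᶜ, (0 : ℝ) ≤ if P2 t φ then 1 else 0 := fun t _ => by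
      split_ifs <;> norm_num
    have he0 : 0 ≤ n * (2 * exp (-(2 * ((p : ℝ) + 1)))) := by positivity
    by_cases h1 : P1 φ
    · refine htriv.trans (le_mul_of_one_le_right (by positivity) ?_)
      rw [if_pos h1]
      linarith [Finset.sum_nonneg hs0]
    by_cases h2 : ∃ t ∈ Tᶜ, P2 t φ
    · obtain ⟨t, ht, h2⟩ := h2
      refine htriv.trans (le_mul_of_one_le_right (by positivity) ?_)
      have := Finset.single_le_sum hs0 ht
      rw [if_pos h2] at this
      rw [if_neg h1]
      linarith
    · push Not at h2
      obtain ⟨w, hw, hr⟩ := recovers_image hm φ (not_not.1 h1)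
      have hsub : (Finset.univ.filter fun z => ¬ Recovers U T (Finset.univ.image φ) z) ⊆
          Tᶜ.biUnion fun t => Finset.univ.filter fun z : ↥T → Bool =>
            1 ≤ |w t ⬝ᵥ fun i => boolSign (z i)| := by
        intro z hz
        by_contra hc
        simp only [Finset.mem_biUnion, Finset.mem_filter, Finset.mem_univ, true_and,
          Finset.mem_compl, not_exists, not_and, not_le] at hc hz
        exact hz (hr z hc)
      have hcard : ((Finset.univ.filter fun z =>
          ¬ Recovers U T (Finset.univ.image φ) z).card : ℝ) ≤
          ∑ t ∈ Tᶜ, ((Finset.univ.filter fun z : ↥T → Bool =>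
            1 ≤ |w t ⬝ᵥ fun i => boolSign (z i)|).card : ℝ) := by
        exact_mod_cast (Finset.card_le_card hsub).trans Finset.card_biUnion_le
      have hone : ∀ t ∈ Tᶜ, ((Finset.univ.filter fun z : ↥T → Bool =>
          1 ≤ |w t ⬝ᵥ fun i => boolSign (z i)|).card : ℝ) ≤
          2 ^ T.card * (2 * exp (-(2 * (p + 1)))) := by
        intro t ht
        have h3 := not_le.1 (h2 t ht)
        have h4 : (w t ⬝ᵥ w t) * m ≤ 768 * (D * (T.card + 4 * (p + 1))) := by
          refine le_of_mul_le_mul_right ?_ hm'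
          calc _ = (w t ⬝ᵥ w t) * m ^ 2 := by ring
            _ ≤ 4 * (v t φ ⬝ᵥ v t φ) := hw t
            _ ≤ 4 * (16 * Q) := by gcongr
            _ = _ := by rw [hQ]; ring
        have := card_filter_one_le_of_energy_le (q := p + 1) (by positivity) hm' hD0.le
          (by rw [Fintype.card_coe]; exact h4) (by rw [Fintype.card_coe]; exact hmD)
        rwa [Fintype.card_coe] at this
      refine hcard.trans ((Finset.sum_le_sum hone).trans ?_)
      rw [Finset.sum_const, nsmul_eq_mul, mul_left_comm]
      gcongr
      have h5 : (Tᶜ.card : ℝ) ≤ n := by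
        exact_mod_cast (Finset.card_le_univ _).trans_eq (Fintype.card_fin n)
      have h6 : (0 : ℝ) ≤ if P1 φ then 1 else 0 := (if_neg h1).ge
      have h7 : (Tᶜ.card : ℝ) * (2 * exp (-(2 * (p + 1)))) ≤
          n * (2 * exp (-(2 * (p + 1)))) := by gcongr
      linarith [Finset.sum_nonneg hs0]
  refine (Finset.sum_le_sum fun φ _ => hpt φ).trans ?_
  rw [← Finset.mul_sum, Finset.sum_add_distrib, Finset.sum_add_distrib, Finset.sum_comm,
    Finset.sum_const, nsmul_eq_mul, Finset.card_univ, ← hN]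
  simp only [Finset.sum_boole]
  have hexp : 1 ≤ exp (-(2 * ((p : ℝ) + 1))) * 16 ^ (p + 1) := by
    have h16 : exp (2 * ((p : ℝ) + 1)) ≤ 16 ^ (p + 1) := by
      have : exp (2 * ((p : ℝ) + 1)) = (exp 1 ^ 2) ^ (p + 1) := by
        rw [← exp_nat_mul, ← exp_nat_mul]
        push_cast
        ring_nf
      rw [this]
      have := exp_one_lt_d9
      gcongr
      nlinarith [exp_pos 1]
    rw [Real.exp_neg, inv_mul_eq_div, le_div_iff₀ (exp_pos _), one_mul]
    exact h16
  have hmove : ∀ a b : ℝ, 0 ≤ b → a * 16 ^ (p + 1) ≤ b → a ≤ b * exp (-(2 * (p + 1))) := by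
    intro a b hb h
    refine le_of_mul_le_mul_right (h.trans ?_) (show (0 : ℝ) < 16 ^ (p + 1) by positivity)
    rw [mul_assoc]
    exact le_mul_of_one_le_right hb hexp
  have hN0 : 0 ≤ N := Nat.cast_nonneg _
  have hs1 := hmove _ _ (by positivity) hP1
  have hs2 : ∑ t ∈ Tᶜ, ((Finset.univ.filter (P2 t)).card : ℝ) ≤
      Tᶜ.card * (N * exp (-(2 * (p + 1)))) := by
    rw [← nsmul_eq_mul, ← Finset.sum_const]
    exact Finset.sum_le_sum fun t ht => hmove _ _ hN0 (hP2 t (Finset.mem_compl.1 ht))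
  have hcc : (T.card : ℝ) + Tᶜ.card = n := by
    exact_mod_cast (Finset.card_add_card_compl T).trans (Fintype.card_fin n)
  have hfin : ∀ A S a b e c : ℝ, 0 ≤ c → A ≤ N * a * e → S ≤ b * (N * e) → a + b = n →
      c * (A + S + N * (n * (2 * e))) ≤ N * c * (3 * n * e) := by
    intro A S a b e c hc hA hS hab
    calc _ ≤ c * (N * a * e + b * (N * e) + N * (n * (2 * e))) :=
          mul_le_mul_of_nonneg_left (by linarith) hc
      _ = _ := by rw [← hab]; ring
  exact hfin _ _ _ _ _ _ (by positivity) (by rwa [Finset.sum_boole]) hs2 hcc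

theorem one_sub_le_uprob {α τ : Type*} [Fintype τ] [DecidableEq τ] {s : Finset α} (hs : s.Nonempty)
    (E : α × (τ → Bool) → Prop) {ε : ℝ}
    (h : ∑ a ∈ s, ((Finset.univ.filter fun z => ¬ E (a, z)).card : ℝ) ≤
      s.card * 2 ^ Fintype.card τ * ε) :
    1 - ε ≤ uprob (s ×ˢ (Finset.univ : Finset (τ → Bool))) E := by
  have hcard : ((s ×ˢ (Finset.univ : Finset (τ → Bool))).card : ℝ) =
      s.card * 2 ^ Fintype.card τ := by
    rw [Finset.card_product]
    simp
  have hpos : (0 : ℝ) < s.card * 2 ^ Fintype.card τ := by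
    have : (0 : ℝ) < s.card := by exact_mod_cast hs.card_pos
    positivity
  have hbad : (((s ×ˢ (Finset.univ : Finset (τ → Bool))).filter fun p => ¬ E p).card : ℝ) =
      ∑ a ∈ s, ((Finset.univ.filter fun z => ¬ E (a, z)).card : ℝ) := by
    rw [Finset.card_filter, Finset.sum_product]
    push_cast
    exact Finset.sum_congr rfl fun a _ => by rw [Finset.card_filter]; push_cast; rfl
  have hsplit : (((s ×ˢ (Finset.univ : Finset (τ → Bool))).filter E).card : ℝ) +
      ((s ×ˢ (Finset.univ : Finset (τ → Bool))).filter fun p => ¬ E p).card =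
      s.card * 2 ^ Fintype.card τ := by
    rw [← hcard]
    exact_mod_cast Finset.card_filter_add_card_filter_not _
  rw [uprob, hcard, le_div_iff₀ hpos]
  linarith

theorem abs_le_coh {n : ℕ} (U : Matrix (Fin n) (Fin n) ℝ) (k j : Fin n) : |U k j| ≤ coh U :=
  (le_ciSup (f := fun j => |U k j|) (Set.finite_range _).bddAbove j).trans
    (le_ciSup (f := fun k => ⨆ j, |U k j|) (Set.finite_range _).bddAbove k)

theorem recovers_empty {n : ℕ} (U : Matrix (Fin n) (Fin n) ℝ) (Ω : Finset (Fin n))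
    (z : ↥(∅ : Finset (Fin n)) → Bool) : Recovers U ∅ Ω z := by
  intro x0 h0 _ x _ hne
  have hx0 : x0 = 0 := funext fun t => h0 t (Finset.notMem_empty t)
  subst hx0
  obtain ⟨i, hi⟩ := Function.ne_iff.1 hne
  simp only [Pi.zero_apply, abs_zero, Finset.sum_const_zero]
  exact Finset.sum_pos' (fun _ _ => abs_nonneg _) ⟨i, Finset.mem_univ _, abs_pos.2 hi⟩

theorem recovers_univ {n : ℕ} {U : Matrix (Fin n) (Fin n) ℝ}
    (hU : Uᵀ * U = (n : ℝ) • (1 : Matrix (Fin n) (Fin n) ℝ)) (T : Finset (Fin n))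
    (z : ↥T → Bool) : Recovers U T Finset.univ z := by
  intro x0 _ _ x hx hne
  have h1 : U *ᵥ x = U *ᵥ x0 := funext fun k => hx k (Finset.mem_univ k)
  have h2 : (n : ℝ) • x = (n : ℝ) • x0 := by
    have := congrArg (Uᵀ *ᵥ ·) h1
    simpa only [mulVec_mulVec, hU, smul_mulVec, one_mulVec] using this
  obtain ⟨i, _⟩ := Function.ne_iff.1 hne
  have hn : (n : ℝ) ≠ 0 := by exact_mod_cast i.pos.ne'
  exact absurd (smul_right_injective _ hn h2) hne

/-- The failure probability for a random sample of size `m` without repetition. -/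
theorem one_sub_le_uprob_recovers {n m : ℕ} {U : Matrix (Fin n) (Fin n) ℝ}
    (hU : Uᵀ * U = (n : ℝ) • (1 : Matrix (Fin n) (Fin n) ℝ)) {T : Finset (Fin n)}
    (hT : T.Nonempty) (hm : 0 < m) (hmn : m ≤ n) (p : ℕ)
    (hmD : 20000 * (p + 1) * (T.card * coh U ^ 2) ≤ m) (hn : n ≤ 64 ^ (p + 1)) :
    1 - 3 * n * exp (-(2 * (p + 1))) ≤
      uprob (Finset.powersetCard m (Finset.univ : Finset (Fin n)) ×ˢ
        (Finset.univ : Finset (↥T → Bool))) fun q => Recovers U T q.1 q.2 := by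
  obtain ⟨t, _⟩ := hT
  have : Nonempty (Fin n) := ⟨t⟩
  refine one_sub_le_uprob (Finset.powersetCard_nonempty.2 (by simpa using hmn)) _ ?_
  have h1 := sum_card_not_recovers_le hU ⟨t, ‹_›⟩ hm
    (fun k j => sq_le_sq' (neg_le_of_abs_le (abs_le_coh U k j))
      (le_of_abs_le (abs_le_coh U k j))) p hmD hn
  have h2 := sum_powersetCard_le_sum_image (ι := Fin m)
    (fun Ω => ((Finset.univ.filter fun z => ¬ Recovers U T Ω z).card : ℝ))
    (fun Ω Ω' h => by
      have : (Finset.univ.filter fun z => ¬ Recovers U T Ω' z) ⊆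
          Finset.univ.filter fun z => ¬ Recovers U T Ω z :=
        Finset.monotone_filter_right _ fun z _ hz hz' => hz (hz'.mono h)
      exact Nat.cast_le.2 (Finset.card_le_card this)) (by simpa using hmn)
  rw [Fintype.card_fin m] at h2
  have hpos : (0 : ℝ) < Fintype.card (Fin m → Fin n) := by exact_mod_cast Fintype.card_pos
  refine le_of_mul_le_mul_left (h2.trans ?_) hpos
  rw [Fintype.card_coe]
  refine (mul_le_mul_of_nonneg_left h1 (Nat.cast_nonneg _)).trans_eq ?_
  ring

theorem uprob_eq_one {α : Type*} {s : Finset α} (hs : s.Nonempty) {E : α → Prop}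
    (h : ∀ a ∈ s, E a) : uprob s E = 1 := by
  rw [uprob, Finset.filter_true_of_mem h, div_self]
  exact_mod_cast hs.card_pos.ne'

/-- Theorem 1.1 of Candès–Romberg.  There are absolute constants
`C₀, C₀' > 0` such that: for an `n×n` matrix `U` with `UᵀU = n•I`, a fixed support
`T`, and `δ ∈ (0,1)`, if `Ω` is a uniformly random subset of `{1,…,n}` of size `m`
and `z : T → {±1}` is a uniformly random sign sequence independent of `Ω`, and if
`m ≥ C₀·|T|·μ(U)²·log(n/δ)` and `m ≥ C₀'·log²(n/δ)`, then with probability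
exceeding `1 - δ` every `x⁰` supported on `T` with sign sequence `z` on `T` is the
unique minimizer of `‖x‖₁` subject to `U_Ω x = U_Ω x⁰`. -/
theorem statement0 :
    ∃ C₀ C₀' : ℝ, 0 < C₀ ∧ 0 < C₀' ∧
      ∀ (n m : ℕ) (U : Matrix (Fin n) (Fin n) ℝ),
        Uᵀ * U = (n : ℝ) • (1 : Matrix (Fin n) (Fin n) ℝ) →
        ∀ (T : Finset (Fin n)) (δ : ℝ),
          0 < δ → δ < 1 → m ≤ n →
          C₀ * T.card * coh U ^ 2 * Real.log (n / δ) ≤ m →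
          C₀' * Real.log (n / δ) ^ 2 ≤ m →
          1 - δ <
            uprob (Finset.powersetCard m (Finset.univ : Finset (Fin n)) ×ˢ
                (Finset.univ : Finset (↥T → Bool)))
              (fun p =>
                ∀ x0 : Fin n → ℝ,
                  (∀ t, t ∉ T → x0 t = 0) →
                  (∀ t (ht : t ∈ T),
                    Real.sign (x0 t) = (if p.2 ⟨t, ht⟩ then 1 else -1)) →
                  ∀ x : Fin n → ℝ,
                    (∀ k ∈ p.1, U.mulVec x k = U.mulVec x0 k) →
                    x ≠ x0 →
                    ∑ i, |x0 i| < ∑ i, |x i|) := by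
  refine ⟨80000, 1, by norm_num, one_pos, ?_⟩
  intro n m U hU T δ hδ hδ1 hmn h1 h2
  suffices h : 1 - δ < uprob (Finset.powersetCard m (Finset.univ : Finset (Fin n)) ×ˢ
      (Finset.univ : Finset (↥T → Bool))) fun q => Recovers U T q.1 q.2 by
    unfold Recovers at h
    exact h
  have hne : (Finset.powersetCard m (Finset.univ : Finset (Fin n)) ×ˢ
      (Finset.univ : Finset (↥T → Bool))).Nonempty :=
    (Finset.powersetCard_nonempty.2 (by simpa using hmn)).product Finset.univ_nonempty
  rcases T.eq_empty_or_nonempty with rfl | hT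
  · rw [uprob_eq_one hne fun q _ => recovers_empty U q.1 q.2]
    linarith
  rcases eq_or_lt_of_le hmn with rfl | hlt
  · rw [uprob_eq_one hne fun q hq => ?_]
    · linarith
    · have := (Finset.mem_powersetCard.1 (Finset.mem_product.1 hq).1).2
      rw [Finset.card_eq_iff_eq_univ q.1 |>.1 (by simpa using this)]
      exact recovers_univ hU T q.2
  set L := Real.log (n / δ) with hL
  have hn1 : (1 : ℝ) ≤ n := by exact_mod_cast (by omega : 1 ≤ n)
  have hL0 : 0 < L := Real.log_pos ((one_lt_div hδ).2 (by linarith))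
  have hm : 0 < m := by
    have : (0 : ℝ) < m := lt_of_lt_of_le (by positivity) h2
    exact_mod_cast this
  have hn2 : (2 : ℝ) ≤ n := by exact_mod_cast (by omega : 2 ≤ n)
  have hexp : exp L = n / δ := Real.exp_log (by positivity)
  have hnδ : (n : ℝ) ≤ n / δ := le_div_self (by positivity) hδ hδ1.le
  have hL2 : 1 / 2 < L := by
    have : Real.log 2 ≤ L := Real.log_le_log two_pos (hn2.trans hnδ)
    linarith [Real.log_two_gt_d9]
  obtain ⟨p, hp⟩ : ∃ p : ℕ, ⌈2 * L⌉₊ = p + 1 :=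
    Nat.exists_eq_succ_of_ne_zero (Nat.ceil_pos.2 (by positivity)).ne'
  have hp1 : 2 * L ≤ p + 1 := by exact_mod_cast hp ▸ Nat.le_ceil (2 * L)
  have hp2 : (p : ℝ) + 1 ≤ 4 * L := by
    have := (Nat.ceil_lt_add_one (by positivity : 0 ≤ 2 * L)).le
    rw [hp] at this
    push_cast at this
    linarith
  have hn64 : n ≤ 64 ^ (p + 1) := by
    have : (n : ℝ) ≤ 64 ^ (p + 1) := by
      calc (n : ℝ) ≤ exp L := hexp ▸ hnδ
        _ ≤ exp ((p + 1 : ℕ) * 1) := exp_le_exp.2 (by push_cast; linarith)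
        _ = exp 1 ^ (p + 1) := Real.exp_nat_mul _ _
        _ ≤ _ := by
          gcongr
          linarith [exp_one_lt_d9]
    exact_mod_cast this
  refine lt_of_lt_of_le ?_ (one_sub_le_uprob_recovers hU hT hm hmn p (h1.trans' ?_) hn64)
  · have h3 : exp (-(2 * ((p : ℝ) + 1))) ≤ (δ / n) ^ 4 := by
      calc _ ≤ exp (-((4 : ℕ) * L)) := exp_le_exp.2 (by push_cast; linarith)
        _ = _ := by rw [Real.exp_neg, Real.exp_nat_mul, hexp, ← inv_pow, inv_div]
    have h4 : 3 * n * (δ / n) ^ 4 < δ := by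
      rw [div_pow, ← mul_div_assoc, div_lt_iff₀ (by positivity)]
      have h5 : δ ^ 4 ≤ δ := pow_le_of_le_one hδ.le hδ1.le (by norm_num)
      have h6 : (8 : ℝ) ≤ n ^ 3 := by
        calc (8 : ℝ) = 2 ^ 3 := by norm_num
          _ ≤ n ^ 3 := by gcongr
      calc 3 * n * δ ^ 4 ≤ 3 * n * δ := by gcongr
        _ < 8 * n * δ := by gcongr; norm_num
        _ ≤ n ^ 3 * n * δ := by gcongr
        _ = _ := by ring
    have h7 : 3 * n * exp (-(2 * ((p : ℝ) + 1))) ≤ 3 * n * (δ / n) ^ 4 := by gcongr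
    linarith
  · calc 20000 * ((p : ℝ) + 1) * (T.card * coh U ^ 2) ≤
          20000 * (4 * L) * (T.card * coh U ^ 2) := by gcongr
      _ = _ := by ring
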